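/- arXiv:1505.00196 — 3 statements merged into one kernel-verified Lean document; each statement's English description precedes it below -/
import Mathlib

section
/- Let Ψ : ℝ → [0,∞) be a finite-valued Young function satisfying the Δ₂-condition, and let L_Ψ denote the set of Lebesgue-measurable functions g : ℝ → ℝ with ∫_ℝ Ψ(|g(s)|) ds < ∞, equipped with the Luxemburg norm ‖g‖₀ := inf{a > 0 : ∫_ℝ Ψ(|g(s)|/a) ds ≤ 1}. Suppose f ∈ L_Ψ ∩ L¹(ℝ) and the Fourier transform of f never vanishes, i.e. ∫_ℝ e^{-2πiξs} f(s) ds ≠ 0 for every ξ ∈ ℝ. Then the linear span of the translated reflections {s ↦ f(t − s) : t ∈ ℝ} is dense in L_Ψ with respect to ‖·‖₀; that is, for every g ∈ L_Ψ and every ε > 0 there exist n ∈ ℕ, real coefficients θ₁,…,θₙ and real numbers t₁,…,tₙ such that ‖g − Σ_{j=1}^n θⱼ f(tⱼ − ·)‖₀ < ε. -/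
open MeasureTheory Real Set

open Filter Topology ENNReal

/-- A finite convex function vanishing at the origin, with the `Δ₂` growth condition. -/
structure DoublingYoung (Ψ : ℝ → ℝ) : Prop where
  nonneg : ∀ x, 0 ≤ Ψ x
  map_zero : Ψ 0 = 0
  convexOn : ConvexOn ℝ univ Ψ
  doubling : ∃ K > 0, ∀ x ≥ 0, Ψ (2 * x) ≤ K * Ψ x

/-- The modular `∫ Ψ(‖h‖)` of a complex-valued function. -/
noncomputable def modular (Ψ : ℝ → ℝ) (h : ℝ → ℂ) : ℝ≥0∞ :=
  ∫⁻ s, ENNReal.ofReal (Ψ ‖h s‖)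

namespace DoublingYoung

variable {Ψ : ℝ → ℝ}

theorem map_mul_le (hΨ : DoublingYoung Ψ) {t x : ℝ} (ht₀ : 0 ≤ t) (ht₁ : t ≤ 1) :
    Ψ (t * x) ≤ t * Ψ x := by
  have := hΨ.convexOn.2 (mem_univ x) (mem_univ 0) ht₀ (sub_nonneg.2 ht₁) (by ring)
  simpa [hΨ.map_zero] using this

theorem mono (hΨ : DoublingYoung Ψ) {x y : ℝ} (hx : 0 ≤ x) (hxy : x ≤ y) : Ψ x ≤ Ψ y := by
  rcases hx.eq_or_lt with rfl | hx
  · rw [hΨ.map_zero]; exact hΨ.nonneg y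
  have hy : 0 < y := hx.trans_le hxy
  have h1 : x / y ≤ 1 := (div_le_one hy).2 hxy
  have := hΨ.map_mul_le (x := y) (by positivity : 0 ≤ x / y) h1
  rw [div_mul_cancel₀ _ hy.ne'] at this
  exact this.trans (mul_le_of_le_one_left (hΨ.nonneg y) h1)

theorem continuous (hΨ : DoublingYoung Ψ) : Continuous Ψ :=
  continuousOn_univ.1 (hΨ.convexOn.continuousOn isOpen_univ)

theorem exists_map_add_le (hΨ : DoublingYoung Ψ) :
    ∃ C : ℝ, 0 ≤ C ∧ ∀ x y, 0 ≤ x → 0 ≤ y → Ψ (x + y) ≤ C * (Ψ x + Ψ y) := by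
  obtain ⟨K, hK, h⟩ := hΨ.doubling
  refine ⟨K / 2, by positivity, fun x y hx hy => ?_⟩
  have h1 := h ((x + y) / 2) (by positivity)
  have h2 := hΨ.convexOn.2 (mem_univ x) (mem_univ y) (by norm_num : (0 : ℝ) ≤ 1 / 2)
    (by norm_num : (0 : ℝ) ≤ 1 / 2) (by norm_num)
  simp only [smul_eq_mul] at h2
  rw [show 1 / 2 * x + 1 / 2 * y = (x + y) / 2 by ring] at h2
  rw [show 2 * ((x + y) / 2) = x + y by ring] at h1
  nlinarith

theorem exists_map_mul_le (hΨ : DoublingYoung Ψ) (c : ℝ) :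
    ∃ C : ℝ, 0 ≤ C ∧ ∀ x, 0 ≤ x → Ψ (|c| * x) ≤ C * Ψ x := by
  obtain ⟨K, hK, h⟩ := hΨ.doubling
  have hpow : ∀ n : ℕ, ∀ x ≥ 0, Ψ (2 ^ n * x) ≤ K ^ n * Ψ x := by
    intro n
    induction n with
    | zero => intro x _; simp
    | succ n ih =>
      intro x hx
      calc Ψ (2 ^ (n + 1) * x) = Ψ (2 * (2 ^ n * x)) := by ring_nf
        _ ≤ K * Ψ (2 ^ n * x) := h _ (by positivity)
        _ ≤ K * (K ^ n * Ψ x) := by gcongr; exact ih x hx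
        _ = K ^ (n + 1) * Ψ x := by ring
  obtain ⟨n, hn⟩ := pow_unbounded_of_one_lt |c| (one_lt_two : (1 : ℝ) < 2)
  exact ⟨K ^ n, by positivity, fun x hx =>
    (hΨ.mono (by positivity) (by gcongr)).trans (hpow n x hx)⟩

theorem measurable_comp_norm (hΨ : DoublingYoung Ψ) {α : Type*} [MeasurableSpace α] {h : α → ℂ}
    (hh : Measurable h) : Measurable fun s => ENNReal.ofReal (Ψ ‖h s‖) :=
  ENNReal.measurable_ofReal.comp (hΨ.continuous.measurable.comp hh.norm)

theorem modular_zero (hΨ : DoublingYoung Ψ) : modular Ψ 0 = 0 := by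
  simp [modular, hΨ.map_zero]

theorem exists_modular_add_le (hΨ : DoublingYoung Ψ) :
    ∃ C : ℝ≥0∞, C ≠ ∞ ∧ ∀ g h : ℝ → ℂ, Measurable g →
      modular Ψ (g + h) ≤ C * (modular Ψ g + modular Ψ h) := by
  obtain ⟨C, hC, hle⟩ := hΨ.exists_map_add_le
  refine ⟨ENNReal.ofReal C, ENNReal.ofReal_ne_top, fun g h hg => ?_⟩
  unfold modular
  rw [← lintegral_add_left (hΨ.measurable_comp_norm hg),
    ← lintegral_const_mul' _ _ ENNReal.ofReal_ne_top]
  refine lintegral_mono fun s => ?_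
  simp only [Pi.add_apply]
  rw [← ENNReal.ofReal_add (hΨ.nonneg _) (hΨ.nonneg _), ← ENNReal.ofReal_mul hC]
  exact ENNReal.ofReal_le_ofReal ((hΨ.mono (norm_nonneg _) (norm_add_le _ _)).trans
    (hle _ _ (norm_nonneg _) (norm_nonneg _)))

theorem exists_modular_smul_le (hΨ : DoublingYoung Ψ) (c : ℂ) :
    ∃ C : ℝ≥0∞, C ≠ ∞ ∧ ∀ h : ℝ → ℂ, modular Ψ (c • h) ≤ C * modular Ψ h := by
  obtain ⟨C, hC, hle⟩ := hΨ.exists_map_mul_le ‖c‖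
  refine ⟨ENNReal.ofReal C, ENNReal.ofReal_ne_top, fun h => ?_⟩
  unfold modular
  rw [← lintegral_const_mul' _ _ ENNReal.ofReal_ne_top]
  refine lintegral_mono fun s => ?_
  rw [← ENNReal.ofReal_mul hC]
  refine ENNReal.ofReal_le_ofReal ?_
  have := hle ‖h s‖ (norm_nonneg _)
  rwa [abs_norm, ← norm_smul] at this

/-- Jensen's inequality for a kernel of mass at most one. -/
theorem map_norm_integral_le (hΨ : DoublingYoung Ψ) {k H : ℝ → ℂ} (hk : Integrable k)
    (hk₁ : ∫ y, ‖k y‖ ≤ 1) (hH : Measurable H) :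
    ENNReal.ofReal (Ψ ‖∫ y, k y * H y‖) ≤ ∫⁻ y, ‖k y‖ₑ * ENNReal.ofReal (Ψ ‖H y‖) := by
  by_cases hi : Integrable fun y => k y * H y
  swap
  · simp [integral_undef hi, hΨ.map_zero]
  by_cases htop : ∫⁻ y, ‖k y‖ₑ * ENNReal.ofReal (Ψ ‖H y‖) = ∞
  · simp [htop]
  have heq : ∀ y, ‖k y‖ₑ * ENNReal.ofReal (Ψ ‖H y‖) = ENNReal.ofReal (‖k y‖ * Ψ ‖H y‖) := by
    intro y
    rw [ENNReal.ofReal_mul (norm_nonneg _), ofReal_norm]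
  simp_rw [heq] at htop ⊢
  have hm : AEStronglyMeasurable (fun y => ‖k y‖ * Ψ ‖H y‖) :=
    hk.1.norm.mul (hΨ.continuous.measurable.comp hH.norm).aestronglyMeasurable
  have hnn : ∀ y, 0 ≤ ‖k y‖ * Ψ ‖H y‖ := fun y => mul_nonneg (norm_nonneg _) (hΨ.nonneg _)
  have hker : Integrable fun y => ‖k y‖ * Ψ ‖H y‖ :=
    ⟨hm, by rw [hasFiniteIntegral_iff_ofReal (ae_of_all _ hnn)]; exact lt_top_iff_ne_top.2 htop⟩
  rw [← ofReal_integral_eq_lintegral_ofReal hker (ae_of_all _ hnn)]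
  refine ENNReal.ofReal_le_ofReal ?_
  have hi' : Integrable fun y => ‖k y‖ * ‖H y‖ := by simpa [norm_mul] using hi.norm
  have hx : ‖∫ y, k y * H y‖ ≤ ∫ y, ‖k y‖ * ‖H y‖ := by
    simpa [norm_mul] using norm_integral_le_integral_norm (fun y => k y * H y)
  refine (hΨ.mono (norm_nonneg _) hx).trans (le_of_forall_lt fun a ha => ?_)
  obtain ⟨b, hab, hb⟩ := exists_between ha
  obtain ⟨l, c, hl, hlc⟩ := hΨ.convexOn.exists_affine_le_of_lt_real (mem_univ _) hb isClosed_univ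
    (hΨ.continuous.lowerSemicontinuous.lowerSemicontinuousOn univ)
  refine hab.trans_le ?_
  have hc : c ≤ 0 := by simpa [hΨ.map_zero] using hl 0 (mem_univ _)
  calc b = l * (∫ y, ‖k y‖ * ‖H y‖) + c := hlc.symm
    _ ≤ l * (∫ y, ‖k y‖ * ‖H y‖) + c * ∫ y, ‖k y‖ := by nlinarith
    _ = ∫ y, l * (‖k y‖ * ‖H y‖) + c * ‖k y‖ := by
        rw [integral_add (hi'.const_mul l) (hk.norm.const_mul c), integral_const_mul,
          integral_const_mul]
    _ ≤ ∫ y, ‖k y‖ * Ψ ‖H y‖ := by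
        refine integral_mono ((hi'.const_mul l).add (hk.norm.const_mul c)) hker fun y => ?_
        have := mul_le_mul_of_nonneg_left (hl ‖H y‖ (mem_univ _)) (norm_nonneg (k y))
        simp only
        linarith

/-- Integrating Jensen's inequality for a kernel of mass at most one. -/
theorem modular_integral_le (hΨ : DoublingYoung Ψ) {k : ℝ → ℂ} (hk : Integrable k)
    (hk₁ : ∫ y, ‖k y‖ ≤ 1) {H : ℝ → ℝ → ℂ} (hH : Measurable fun p : ℝ × ℝ => H p.1 p.2) :
    modular Ψ (fun s => ∫ y, k y * H s y) ≤ ∫⁻ y, ‖k y‖ₑ * modular Ψ (fun s => H s y) := by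
  have hmeas : Measurable fun p : ℝ × ℝ => ENNReal.ofReal (Ψ ‖H p.1 p.2‖) :=
    hΨ.measurable_comp_norm hH
  calc modular Ψ (fun s => ∫ y, k y * H s y)
      ≤ ∫⁻ s, ∫⁻ y, ‖k y‖ₑ * ENNReal.ofReal (Ψ ‖H s y‖) :=
        lintegral_mono fun s => hΨ.map_norm_integral_le hk hk₁ (hH.comp measurable_prodMk_left)
    _ = ∫⁻ y, ∫⁻ s, ‖k y‖ₑ * ENNReal.ofReal (Ψ ‖H s y‖) :=
        lintegral_lintegral_swap ((hk.1.enorm.comp_snd).mul hmeas.aemeasurable)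
    _ = ∫⁻ y, ‖k y‖ₑ * modular Ψ (fun s => H s y) := by
        simp_rw [lintegral_const_mul' _ _ enorm_ne_top]
        rfl

/-- Jensen's inequality for a kernel of arbitrary finite mass. -/
theorem exists_modular_integral_le (hΨ : DoublingYoung Ψ) {k : ℝ → ℂ} (hk : Integrable k) :
    ∃ C : ℝ≥0∞, C ≠ ∞ ∧ ∀ H : ℝ → ℝ → ℂ, Measurable (fun p : ℝ × ℝ => H p.1 p.2) →
      modular Ψ (fun s => ∫ y, k y * H s y) ≤ C * ∫⁻ y, ‖k y‖ₑ * modular Ψ (fun s => H s y) := by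
  set m : ℝ := (∫ y, ‖k y‖) + 1
  have hm : 1 ≤ m := by
    have : 0 ≤ ∫ y, ‖k y‖ := integral_nonneg fun _ => norm_nonneg _
    linarith
  have hm0 : (m : ℂ) ≠ 0 := by exact_mod_cast (by positivity : m ≠ 0)
  obtain ⟨C, hC, hle⟩ := hΨ.exists_modular_smul_le (m : ℂ)
  refine ⟨C, hC, fun H hH => ?_⟩
  have hk' : Integrable fun y => (m : ℂ)⁻¹ * k y := hk.const_mul _
  have hnorm : ∀ y, ‖(m : ℂ)⁻¹ * k y‖ = m⁻¹ * ‖k y‖ := by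
    intro y
    rw [norm_mul, norm_inv, Complex.norm_real, Real.norm_of_nonneg (by positivity)]
  have hk₁ : ∫ y, ‖(m : ℂ)⁻¹ * k y‖ ≤ 1 := by
    simp_rw [hnorm]
    rw [integral_const_mul, inv_mul_le_one₀ (by positivity)]
    linarith
  have heq : (fun s => ∫ y, k y * H s y) = (m : ℂ) • fun s => ∫ y, ((m : ℂ)⁻¹ * k y) * H s y := by
    ext s
    simp only [Pi.smul_apply, smul_eq_mul, mul_assoc]
    rw [integral_const_mul, mul_inv_cancel_left₀ hm0]
  rw [heq]
  refine (hle _).trans ?_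
  gcongr
  refine (hΨ.modular_integral_le hk' hk₁ hH).trans (lintegral_mono fun y => ?_)
  gcongr
  refine enorm_le_iff_norm_le.2 ?_
  rw [hnorm]
  exact mul_le_of_le_one_left (norm_nonneg _) (inv_le_one_of_one_le₀ hm)

end DoublingYoung

theorem MeasureTheory.Integrable.tendsto_lintegral_enorm_sub_translate {F : ℝ → ℂ}
    (hF : Integrable F) :
    Tendsto (fun t => ∫⁻ s, ‖F (s - t) - F s‖ₑ) (𝓝 0) (𝓝 0) := by
  have : Fact ((1 : ℝ≥0∞) ≠ ∞) := ⟨ENNReal.one_ne_top⟩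
  have hp : MemLp F 1 := memLp_one_iff_integrable.2 hF
  have hc : Continuous fun t : ℝ => DomAddAct.mk (-t) +ᵥ hp.toLp F :=
    (DomAddAct.continuous_mk.comp continuous_neg).vadd continuous_const
  have h := hc.tendsto 0
  simp only [neg_zero, DomAddAct.mk_zero, zero_vadd] at h
  rw [tendsto_iff_edist_tendsto_0] at h
  refine h.congr fun t => ?_
  rw [DomAddAct.mk_vadd_toLp, Lp.edist_toLp_toLp, eLpNorm_one_eq_lintegral_enorm]
  simp [sub_eq_neg_add]

theorem ENNReal.exists_pos_mul_le {C ε : ℝ≥0∞} (hC : C ≠ ∞) (hε : ε ≠ 0) :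
    ∃ η : ℝ≥0∞, η ≠ 0 ∧ C * η ≤ ε :=
  ⟨ε / C, ENNReal.div_ne_zero.2 ⟨hε, hC⟩, ENNReal.mul_div_le⟩

namespace DoublingYoung

variable {Ψ : ℝ → ℝ}

theorem modular_le_of_norm_le (hΨ : DoublingYoung Ψ) {v : ℝ → ℂ} {M : ℝ} (hM : 0 < M)
    (hv : ∀ s, ‖v s‖ ≤ M) : modular Ψ v ≤ ENNReal.ofReal (Ψ M / M) * ∫⁻ s, ‖v s‖ₑ := by
  rw [← lintegral_const_mul' _ _ ENNReal.ofReal_ne_top]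
  refine lintegral_mono fun s => ?_
  rw [← ofReal_norm, ← ENNReal.ofReal_mul (div_nonneg (hΨ.nonneg _) hM.le)]
  refine ENNReal.ofReal_le_ofReal ?_
  have := hΨ.map_mul_le (x := M) (div_nonneg (norm_nonneg (v s)) hM.le)
    ((div_le_one hM).2 (hv s))
  rw [div_mul_cancel₀ _ hM.ne'] at this
  exact this.trans (le_of_eq (by ring))

theorem modular_lt_top_of_norm_le (hΨ : DoublingYoung Ψ) {v : ℝ → ℂ} {M : ℝ}
    (hv : ∀ s, ‖v s‖ ≤ M) (hi : Integrable v) : modular Ψ v < ∞ :=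
  (hΨ.modular_le_of_norm_le (by positivity : 0 < |M| + 1)
    fun s => (hv s).trans ((le_abs_self M).trans (by linarith))).trans_lt
    (ENNReal.mul_lt_top ENNReal.ofReal_lt_top hi.2)

/-- Bounded integrable functions are dense for the modular. -/
theorem exists_bounded_modular_sub_lt (hΨ : DoublingYoung Ψ) {F : ℝ → ℂ} (hF : Measurable F)
    (hFfin : modular Ψ F < ∞) {η : ℝ≥0∞} (hη : η ≠ 0) :
    ∃ u : ℝ → ℂ, Measurable u ∧ Integrable u ∧ (∃ M, ∀ s, ‖u s‖ ≤ M) ∧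
      modular Ψ (F - u) < η := by
  let A : ℕ → Set ℝ := fun n => {s | ‖F s‖ ≤ n} ∩ Icc (-n : ℝ) n
  have hA : ∀ n, MeasurableSet (A n) := fun n =>
    (measurableSet_le hF.norm measurable_const).inter measurableSet_Icc
  have hu : ∀ n, Measurable ((A n).indicator F) := fun n => hF.indicator (hA n)
  have hlim : Tendsto (fun n => modular Ψ (F - (A n).indicator F)) atTop (𝓝 0) := by
    have hz : (0 : ℝ≥0∞) = ∫⁻ _ : ℝ, (0 : ℝ≥0∞) := by simp
    rw [hz]
    refine tendsto_lintegral_of_dominated_convergence (fun s => ENNReal.ofReal (Ψ ‖F s‖))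
      (fun n => hΨ.measurable_comp_norm (hF.sub (hu n))) (fun n => ae_of_all _ fun s => ?_)
      hFfin.ne (ae_of_all _ fun s => ?_)
    · refine ENNReal.ofReal_le_ofReal (hΨ.mono (norm_nonneg _) ?_)
      by_cases hs : s ∈ A n <;> simp [hs]
    · obtain ⟨N, hN⟩ := exists_nat_ge (max ‖F s‖ |s|)
      refine tendsto_const_nhds.congr' ?_
      filter_upwards [eventually_ge_atTop N] with n hn
      have hNn : (N : ℝ) ≤ n := by exact_mod_cast hn
      have hs : s ∈ A n :=
        ⟨(le_max_left _ _).trans (hN.trans hNn),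
          abs_le.1 ((le_max_right _ _).trans (hN.trans hNn))⟩
      simp [hs, hΨ.map_zero]
  obtain ⟨n, hn⟩ := (hlim.eventually (gt_mem_nhds (pos_iff_ne_zero.2 hη))).exists
  have hb : ∀ s, ‖(A n).indicator F s‖ ≤ n := by
    intro s
    by_cases hs : s ∈ A n
    · simpa [hs] using hs.1
    · simp [hs]
  refine ⟨_, hu n, ?_, ⟨n, hb⟩, hn⟩
  rw [integrable_indicator_iff (hA n)]
  refine Measure.integrableOn_of_bounded (M := n) ?_ hF.aestronglyMeasurable ?_
  · exact ((measure_mono inter_subset_right).trans_lt measure_Icc_lt_top).ne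
  · exact (ae_restrict_iff' (hA n)).2 (ae_of_all _ fun s hs => hs.1)

theorem modular_translate (h : ℝ → ℂ) (t : ℝ) : modular Ψ (fun s => h (s - t)) = modular Ψ h :=
  lintegral_sub_right_eq_self (fun s => ENNReal.ofReal (Ψ ‖h s‖)) t

theorem tendsto_modular_translate_sub (hΨ : DoublingYoung Ψ) {F : ℝ → ℂ} (hF : Measurable F)
    (hFfin : modular Ψ F < ∞) :
    Tendsto (fun t => modular Ψ (fun s => F (s - t) - F s)) (𝓝 0) (𝓝 0) := by
  obtain ⟨C, hC, hadd⟩ := hΨ.exists_modular_add_le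
  rw [ENNReal.tendsto_nhds_zero]
  intro ε hε
  obtain ⟨η, hη, hle⟩ := ENNReal.exists_pos_mul_le (C := C * (1 + C * 2)) (by finiteness) hε.ne'
  obtain ⟨u, hu, hui, ⟨M, hM⟩, hlt⟩ := hΨ.exists_bounded_modular_sub_lt hF hFfin hη
  have hlim : Tendsto (fun t => modular Ψ (fun s => u (s - t) - u s)) (𝓝 0) (𝓝 0) := by
    have hM' : ∀ s, ‖u s‖ ≤ |M| + 1 := fun s => (hM s).trans ((le_abs_self M).trans (by linarith))
    have h0 := ENNReal.Tendsto.const_mul (a := ENNReal.ofReal (Ψ (2 * (|M| + 1)) / (2 * (|M| + 1))))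
      hui.tendsto_lintegral_enorm_sub_translate (Or.inr ENNReal.ofReal_ne_top)
    rw [mul_zero] at h0
    refine tendsto_of_tendsto_of_tendsto_of_le_of_le tendsto_const_nhds h0 (fun _ => zero_le)
      fun t => hΨ.modular_le_of_norm_le (by positivity) fun s => ?_
    exact (norm_sub_le _ _).trans (by linarith [hM' (s - t), hM' s])
  filter_upwards [ENNReal.tendsto_nhds_zero.1 hlim η (pos_iff_ne_zero.2 hη)] with t ht
  have e1 : (fun s => F (s - t) - F s) =
      (fun s => (F - u) (s - t)) + ((fun s => u (s - t) - u s) + (-1 : ℂ) • (F - u)) := by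
    ext s
    simp
  have h3 : modular Ψ ((-1 : ℂ) • (F - u)) = modular Ψ (F - u) := by
    simp [modular, norm_sub_rev]
  have hut : Measurable fun s => u (s - t) := hu.comp (measurable_id.sub_const t)
  calc modular Ψ (fun s => F (s - t) - F s)
      ≤ C * (modular Ψ (fun s => (F - u) (s - t)) +
          modular Ψ ((fun s => u (s - t) - u s) + (-1 : ℂ) • (F - u))) := by
        rw [e1]
        exact hadd _ _ ((hF.sub hu).comp (measurable_id.sub_const t))
    _ ≤ C * (η + C * (η + η)) := by
        gcongr
        · rw [modular_translate]; exact hlt.le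
        · refine (hadd _ _ (hut.sub hu)).trans ?_
          rw [h3]
          gcongr
          exact ht
    _ = C * (1 + C * 2) * η := by ring
    _ ≤ ε := hle

/-- If `p n → q` pointwise, the averages of the translates of `F` by `p n` against an integrable
kernel converge for the modular to the average of its translates by `q`. -/
theorem tendsto_modular_average_translate (hΨ : DoublingYoung Ψ) {F k : ℝ → ℂ}
    (hF : Measurable F) (hFi : Integrable F) (hFfin : modular Ψ F < ∞) (hk : Measurable k)
    (hki : Integrable k) {p : ℕ → ℝ → ℝ} {q : ℝ → ℝ} (hp : ∀ n, Measurable (p n))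
    (hq : Measurable q) (hpq : ∀ y, Tendsto (fun n => p n y) atTop (𝓝 (q y))) :
    Tendsto (fun n => modular Ψ
      (fun s => (∫ y, k y * F (s - p n y)) - ∫ y, k y * F (s - q y))) atTop (𝓝 0) := by
  have hjoint : ∀ {r : ℝ → ℝ}, Measurable r → Measurable fun z : ℝ × ℝ => F (z.1 - r z.2) :=
    fun hr => hF.comp (measurable_fst.sub (hr.comp measurable_snd))
  have hker : ∀ {r : ℝ → ℝ}, Measurable r → ∀ᵐ s, Integrable fun y => k y * F (s - r y) := by
    intro r hr
    have hm : AEStronglyMeasurable (fun z : ℝ × ℝ => k z.2 * F (z.1 - r z.2))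
        (volume.prod volume) :=
      ((hk.comp measurable_snd).mul (hjoint hr)).aestronglyMeasurable
    have hi : Integrable (fun z : ℝ × ℝ => k z.2 * F (z.1 - r z.2)) (volume.prod volume) := by
      rw [integrable_prod_iff' hm]
      refine ⟨ae_of_all _ fun y => (hFi.comp_sub_right (r y)).const_mul (k y), ?_⟩
      simp only [norm_mul, integral_const_mul]
      have : ∀ y, ∫ s, ‖F (s - r y)‖ = ∫ s, ‖F s‖ := fun y =>
        integral_sub_right_eq_self (fun s => ‖F s‖) (r y)
      simp only [this]
      exact hki.norm.mul_const _
    exact hi.prod_right_ae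
  obtain ⟨J, hJ, hJle⟩ := hΨ.exists_modular_integral_le hki
  obtain ⟨C, hC, hadd⟩ := hΨ.exists_modular_add_le
  let D : ℕ → ℝ → ℝ≥0∞ := fun n y => modular Ψ (fun s => F (s - p n y) - F (s - q y))
  have hDmeas : ∀ n, Measurable (D n) := by
    intro n
    have := hΨ.measurable_comp_norm ((hjoint (hp n)).sub (hjoint hq))
    exact this.lintegral_prod_left'
  have hDle : ∀ n y, D n y ≤ C * (modular Ψ F + modular Ψ F) := by
    intro n y
    have e : (fun s => F (s - p n y) - F (s - q y)) =
        (fun s => F (s - p n y)) + fun s => (-F) (s - q y) := by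
      ext s; simp [sub_eq_add_neg]
    have hneg : modular Ψ (-F) = modular Ψ F := by simp [modular]
    simp only [D]
    rw [e]
    refine (hadd (fun s => F (s - p n y)) _ (hF.comp (measurable_id.sub_const _))).trans ?_
    rw [modular_translate, modular_translate, hneg]
  have hDlim : ∀ y, Tendsto (fun n => D n y) atTop (𝓝 0) := by
    intro y
    have h0 : Tendsto (fun n => p n y - q y) atTop (𝓝 0) := by
      simpa using (hpq y).sub_const (q y)
    refine ((hΨ.tendsto_modular_translate_sub hF hFfin).comp h0).congr fun n => ?_
    have := modular_translate (Ψ := Ψ) (fun s => F (s - (p n y - q y)) - F s) (q y)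
    simp only [Function.comp_apply, D]
    rw [← this]
    congr 1
    ext s
    ring_nf
  have hlim : Tendsto (fun n => ∫⁻ y, ‖k y‖ₑ * D n y) atTop (𝓝 0) := by
    have hz : (0 : ℝ≥0∞) = ∫⁻ _ : ℝ, (0 : ℝ≥0∞) := by simp
    rw [hz]
    refine tendsto_lintegral_of_dominated_convergence
      (fun y => ‖k y‖ₑ * (C * (modular Ψ F + modular Ψ F)))
      (fun n => hk.enorm.mul (hDmeas n)) (fun n => ae_of_all _ fun y => ?_) ?_
      (ae_of_all _ fun y => ?_)
    · exact mul_le_mul_right (hDle n y) _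
    · rw [lintegral_mul_const' _ _ (by finiteness)]
      exact ENNReal.mul_ne_top hki.2.ne (by finiteness)
    · simpa using ENNReal.Tendsto.const_mul (hDlim y) (Or.inr enorm_ne_top)
  have hlim' := ENNReal.Tendsto.const_mul hlim (Or.inr hJ)
  rw [mul_zero] at hlim'
  refine tendsto_of_tendsto_of_tendsto_of_le_of_le tendsto_const_nhds hlim' (fun _ => zero_le)
    fun n => le_trans (le_of_eq ?_) (hJle _ ((hjoint (hp n)).sub (hjoint hq)))
  refine lintegral_congr_ae ?_
  filter_upwards [hker (hp n), hker hq] with s h1 h2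
  simp only [mul_sub]
  rw [integral_sub h1 h2]

end DoublingYoung

/-- The linear span of the translates of `F`. -/
def translateSpan (F : ℝ → ℂ) : Submodule ℂ (ℝ → ℂ) :=
  Submodule.span ℂ (range fun t s => F (s - t))

/-- `h` is a limit, for the modular, of linear combinations of translates of `F`. -/
def Approximable (Ψ : ℝ → ℝ) (F h : ℝ → ℂ) : Prop :=
  ∀ η : ℝ≥0∞, η ≠ 0 → ∃ p ∈ translateSpan F, modular Ψ (h - p) < η

theorem measurable_of_mem_translateSpan {F p : ℝ → ℂ} (hF : Measurable F)
    (hp : p ∈ translateSpan F) : Measurable p := by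
  induction hp using Submodule.span_induction with
  | mem x h =>
    obtain ⟨t, rfl⟩ := h
    exact hF.comp (measurable_id.sub_const t)
  | zero => exact measurable_const
  | add x y _ _ hx hy => exact hx.add hy
  | smul c x _ hx => exact hx.const_smul c

namespace Approximable

variable {Ψ : ℝ → ℝ} {F g h : ℝ → ℂ}

theorem zero (hΨ : DoublingYoung Ψ) : Approximable Ψ F 0 := fun η hη =>
  ⟨0, Submodule.zero_mem _, by simpa [hΨ.modular_zero] using pos_iff_ne_zero.2 hη⟩

theorem of_forall_exists (hΨ : DoublingYoung Ψ) (hh : Measurable h)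
    (H : ∀ η : ℝ≥0∞, η ≠ 0 → ∃ g, Measurable g ∧ Approximable Ψ F g ∧ modular Ψ (h - g) ≤ η) :
    Approximable Ψ F h := by
  obtain ⟨C, hC, hadd⟩ := hΨ.exists_modular_add_le
  intro ε hε
  obtain ⟨ε', hε'0, hε'⟩ := exists_between (pos_iff_ne_zero.2 hε)
  obtain ⟨η, hη, hle⟩ := ENNReal.exists_pos_mul_le (C := C * 2) (by finiteness) hε'0.ne'
  obtain ⟨g, hg, hgA, hgη⟩ := H η hη
  obtain ⟨p, hp, hpη⟩ := hgA η hη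
  refine ⟨p, hp, lt_of_le_of_lt ?_ hε'⟩
  have e : h - p = (h - g) + (g - p) := by abel
  calc modular Ψ (h - p) ≤ C * (modular Ψ (h - g) + modular Ψ (g - p)) := by
        rw [e]; exact hadd _ _ (hh.sub hg)
    _ ≤ C * (η + η) := by gcongr
    _ = C * 2 * η := by ring
    _ ≤ ε' := hle

theorem add (hΨ : DoublingYoung Ψ) (hF : Measurable F) (hg : Measurable g)
    (hgA : Approximable Ψ F g) (hhA : Approximable Ψ F h) : Approximable Ψ F (g + h) := by
  obtain ⟨C, hC, hadd⟩ := hΨ.exists_modular_add_le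
  intro ε hε
  obtain ⟨ε', hε'0, hε'⟩ := exists_between (pos_iff_ne_zero.2 hε)
  obtain ⟨η, hη, hle⟩ := ENNReal.exists_pos_mul_le (C := C * 2) (by finiteness) hε'0.ne'
  obtain ⟨p, hp, hpη⟩ := hgA η hη
  obtain ⟨q, hq, hqη⟩ := hhA η hη
  refine ⟨p + q, Submodule.add_mem _ hp hq, lt_of_le_of_lt ?_ hε'⟩
  have e : g + h - (p + q) = (g - p) + (h - q) := by abel
  calc modular Ψ (g + h - (p + q)) ≤ C * (modular Ψ (g - p) + modular Ψ (h - q)) := by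
        rw [e]; exact hadd _ _ (hg.sub (measurable_of_mem_translateSpan hF hp))
    _ ≤ C * (η + η) := by gcongr
    _ = C * 2 * η := by ring
    _ ≤ ε' := hle

theorem smul (hΨ : DoublingYoung Ψ) (c : ℂ) (hhA : Approximable Ψ F h) :
    Approximable Ψ F (c • h) := by
  obtain ⟨C, hC, hsmul⟩ := hΨ.exists_modular_smul_le c
  intro ε hε
  obtain ⟨ε', hε'0, hε'⟩ := exists_between (pos_iff_ne_zero.2 hε)
  obtain ⟨η, hη, hle⟩ := ENNReal.exists_pos_mul_le hC hε'0.ne'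
  obtain ⟨p, hp, hpη⟩ := hhA η hη
  refine ⟨c • p, Submodule.smul_mem _ c hp, lt_of_le_of_lt ?_ hε'⟩
  rw [← smul_sub]
  exact (hsmul _).trans ((mul_le_mul_right hpη.le C).trans hle)

end Approximable

theorem integral_mul_simpleFunc_translate_mem {F k : ℝ → ℂ} (hki : Integrable k)
    (p : SimpleFunc ℝ ℝ) : (fun s => ∫ y, k y * F (s - p y)) ∈ translateSpan F := by
  have e : (fun s => ∫ y, k y * F (s - p y)) =
      ∑ t ∈ p.range, (∫ y in p ⁻¹' {t}, k y) • fun s => F (s - t) := by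
    ext s
    have h1 : ∀ y, k y * F (s - p y) =
        ∑ t ∈ p.range, (p ⁻¹' {t}).indicator k y * F (s - t) := by
      intro y
      rw [Finset.sum_eq_single (p y)]
      · simp
      · intro t _ ht
        simp [ht.symm]
      · intro h
        exact absurd (p.mem_range_self y) h
    simp_rw [h1]
    rw [integral_finsetSum _ fun t _ =>
      (hki.indicator (p.measurableSet_fiber t)).mul_const (F (s - t))]
    simp only [Finset.sum_apply, Pi.smul_apply, smul_eq_mul]
    refine Finset.sum_congr rfl fun t _ => ?_
    rw [integral_mul_const, integral_indicator (p.measurableSet_fiber t)]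
  rw [e]
  exact Submodule.sum_mem _ fun t _ =>
    Submodule.smul_mem _ _ (Submodule.subset_span (mem_range_self t))

theorem approximable_convolution {Ψ : ℝ → ℝ} (hΨ : DoublingYoung Ψ) {F k : ℝ → ℂ}
    (hF : Measurable F) (hFi : Integrable F) (hFfin : modular Ψ F < ∞) (hk : Measurable k)
    (hki : Integrable k) : Approximable Ψ F (fun s => ∫ y, k y * F (s - y)) := by
  intro η hη
  let p : ℕ → SimpleFunc ℝ ℝ := SimpleFunc.approxOn id measurable_id univ 0 (mem_univ 0)
  have hlim := hΨ.tendsto_modular_average_translate hF hFi hFfin hk hki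
    (p := fun n => p n) (q := id) (fun n => (p n).measurable) measurable_id
    (fun y => SimpleFunc.tendsto_approxOn measurable_id (mem_univ 0) (by simp))
  obtain ⟨n, hn⟩ := (hlim.eventually (gt_mem_nhds (pos_iff_ne_zero.2 hη))).exists
  refine ⟨_, integral_mul_simpleFunc_translate_mem hki (p n), lt_of_le_of_lt (le_of_eq ?_) hn⟩
  simp only [modular, Pi.sub_apply, id]
  simp_rw [norm_sub_rev]

open scoped FourierTransform Convolution

/-- Convolution of complex-valued functions on the line. -/
local notation:67 f:67 "⋆ₘ" g:66 => convolution f g (ContinuousLinearMap.mul ℂ ℂ) volume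

theorem mulConvolution_apply (k h : ℝ → ℂ) (s : ℝ) : (k ⋆ₘ h) s = ∫ y, k y * h (s - y) := rfl

theorem mulConvolution_comm (k h : ℝ → ℂ) : k ⋆ₘ h = h ⋆ₘ k := by
  rw [← convolution_flip]
  congr 1
  ext
  simp

/-- Continuous integrable functions whose Fourier transform vanishes off `[a, b]`. -/
structure BandLimited (φ : ℝ → ℂ) (a b : ℝ) : Prop where
  continuous : Continuous φ
  integrable : Integrable φ
  mem_Icc : ∀ ξ, 𝓕 φ ξ ≠ 0 → ξ ∈ Icc a b

theorem continuous_fourier {φ : ℝ → ℂ} (hφ : Integrable φ) : Continuous (𝓕 φ) :=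
  VectorFourier.fourierIntegral_continuous Real.continuous_fourierChar
    (by exact continuous_inner) hφ

namespace BandLimited

variable {φ ψ k : ℝ → ℂ} {a b : ℝ}

theorem mono (h : BandLimited φ a b) {a' b' : ℝ} (ha : a' ≤ a) (hb : b ≤ b') :
    BandLimited φ a' b' :=
  ⟨h.continuous, h.integrable, fun ξ hξ => Icc_subset_Icc ha hb (h.mem_Icc ξ hξ)⟩

theorem integrable_fourier (h : BandLimited φ a b) : Integrable (𝓕 φ) :=
  (continuous_fourier h.integrable).integrable_of_hasCompactSupport
    (HasCompactSupport.intro isCompact_Icc fun ξ hξ => by_contra fun hne => hξ (h.mem_Icc ξ hne))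

theorem eq_of_fourier_eq (h : BandLimited φ a b) (h' : BandLimited ψ a b) (he : 𝓕 φ = 𝓕 ψ) :
    φ = ψ := by
  rw [← h.continuous.fourierInv_fourier_eq h.integrable h.integrable_fourier, he,
    h'.continuous.fourierInv_fourier_eq h'.integrable h'.integrable_fourier]

theorem exists_norm_le (h : BandLimited φ a b) : ∃ M, ∀ s, ‖φ s‖ ≤ M := by
  refine ⟨∫ ξ, ‖𝓕 φ ξ‖, fun s => ?_⟩
  rw [← congrFun (h.continuous.fourierInv_fourier_eq h.integrable h.integrable_fourier) s,
    Real.fourierInv_eq]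
  exact (norm_integral_le_integral_norm _).trans_eq (by simp only [Circle.norm_smul])

theorem convolution (h : BandLimited φ a b) (hk : Integrable k) : BandLimited (k ⋆ₘ φ) a b := by
  obtain ⟨M, hM⟩ := h.exists_norm_le
  refine ⟨?_, hk.integrable_convolution _ h.integrable, fun ξ hξ => h.mem_Icc ξ fun h0 => hξ ?_⟩
  · refine BddAbove.continuous_convolution_right_of_integrable (ContinuousLinearMap.mul ℂ ℂ)
      ⟨M, ?_⟩ hk h.continuous
    rintro _ ⟨s, rfl⟩
    exact hM s
  · rw [Real.fourier_mul_convolution_eq hk h.integrable, h0, mul_zero]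

end BandLimited

theorem exists_bandLimited_eq_one : ∃ V : ℝ → ℂ, BandLimited V (-2) 2 ∧
    ∀ ξ, |ξ| ≤ 1 → 𝓕 V ξ = 1 := by
  let χ : ContDiffBump (0 : ℝ) := ⟨1, 2, one_pos, one_lt_two⟩
  have h1 : HasCompactSupport fun ξ => (χ ξ : ℂ) :=
    χ.hasCompactSupport.comp_left (g := fun x : ℝ => (x : ℂ)) Complex.ofReal_zero
  have h2 : ContDiff ℝ ((⊤ : ℕ∞) : WithTop ℕ∞) fun ξ => (χ ξ : ℂ) :=
    Complex.ofRealCLM.contDiff.comp χ.contDiff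
  let S : SchwartzMap ℝ ℂ := h1.toSchwartzMap h2
  let T : SchwartzMap ℝ ℂ := 𝓕⁻ S
  have hS : 𝓕 (⇑T) = fun ξ => (χ ξ : ℂ) := by
    rw [← SchwartzMap.fourier_coe, FourierTransform.fourier_fourierInv_eq]
    rfl
  refine ⟨T, ⟨T.continuous, T.integrable, fun ξ hξ => ?_⟩, fun ξ hξ => ?_⟩
  · rw [hS] at hξ
    by_contra hc
    refine hξ ?_
    have : 2 ≤ |ξ| := by
      by_contra! hlt
      exact hc (abs_le.1 hlt.le)
    simpa using χ.zero_of_le_dist (x := ξ) (by simpa using this)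
  · rw [hS]
    simpa using χ.one_of_mem_closedBall (x := ξ) (by simpa using hξ)

/-- The function whose Fourier transform is that of `V` rescaled by `δ` and centred at `ξ`. -/
noncomputable def modulatedDilation (V : ℝ → ℂ) (ξ δ : ℝ) (s : ℝ) : ℂ :=
  ((𝐞 (s * ξ) : Circle) : ℂ) * (δ * V (δ * s))

theorem fourier_modulatedDilation (V : ℝ → ℂ) (ξ : ℝ) {δ : ℝ} (hδ : 0 < δ) (η : ℝ) :
    𝓕 (modulatedDilation V ξ δ) η = 𝓕 V ((η - ξ) / δ) := by
  rw [Real.fourier_real_eq, Real.fourier_real_eq]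
  have h := Measure.integral_comp_mul_left (fun x => 𝐞 (-(x * ((η - ξ) / δ))) • V x) δ
  rw [abs_of_pos (inv_pos.2 hδ), eq_inv_smul_iff₀ hδ.ne', ← integral_smul] at h
  rw [← h]
  congr 1
  ext s
  have e : -(δ * s * ((η - ξ) / δ)) = -(s * η) + s * ξ := by
    field_simp
    ring
  simp only [modulatedDilation, Circle.smul_def, smul_eq_mul, Complex.real_smul]
  rw [e, AddChar.map_add_eq_mul, Circle.coe_mul]
  ring

theorem BandLimited.modulatedDilation {V : ℝ → ℂ} (hV : BandLimited V (-2) 2) (ξ : ℝ) {δ : ℝ}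
    (hδ : 0 < δ) : BandLimited (modulatedDilation V ξ δ) (ξ - 2 * δ) (ξ + 2 * δ) where
  continuous := by
    have := hV.continuous
    have h2 := Real.continuous_fourierChar
    unfold _root_.modulatedDilation
    fun_prop
  integrable := by
    have h1 : Integrable fun s => (δ : ℂ) * V (δ * s) :=
      (hV.integrable.comp_mul_left' hδ.ne').const_mul _
    have h2 := Real.continuous_fourierChar
    refine h1.bdd_mul (c := 1) (Continuous.aestronglyMeasurable (by fun_prop))
      (ae_of_all _ fun s => (Circle.norm_coe _).le)
  mem_Icc η hη := by
    rw [fourier_modulatedDilation V ξ hδ] at hη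
    have := hV.mem_Icc _ hη
    rw [Set.mem_Icc, le_div_iff₀ hδ, div_le_iff₀ hδ] at this
    constructor <;> linarith [this.1, this.2]

theorem tendsto_lintegral_enorm_mul_translate {F V : ℝ → ℂ} (hF : Measurable F)
    (hFi : Integrable F)
    (hV : Measurable V) (hVi : Integrable V) :
    Tendsto (fun δ : ℝ => ∫⁻ y, ‖F y‖ₑ * ∫⁻ s, ‖V (s - δ * y) - V s‖ₑ) (𝓝 0) (𝓝 0) := by
  have hz : (0 : ℝ≥0∞) = ∫⁻ _ : ℝ, (0 : ℝ≥0∞) := by simp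
  conv => rhs; rw [hz]
  refine tendsto_lintegral_filter_of_dominated_convergence
    (fun y => ‖F y‖ₑ * ((∫⁻ s, ‖V s‖ₑ) + ∫⁻ s, ‖V s‖ₑ)) (Eventually.of_forall fun δ => ?_)
    (Eventually.of_forall fun δ => ae_of_all _ fun y => ?_) ?_ (ae_of_all _ fun y => ?_)
  · refine hF.enorm.mul ?_
    have : Measurable fun z : ℝ × ℝ => ‖V (z.1 - δ * z.2) - V z.1‖ₑ := by fun_prop
    exact this.lintegral_prod_left'
  · refine mul_le_mul_right ?_ _
    calc ∫⁻ s, ‖V (s - δ * y) - V s‖ₑ ≤ ∫⁻ s, (‖V (s - δ * y)‖ₑ + ‖V s‖ₑ) :=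
          lintegral_mono fun s => enorm_sub_le
      _ = (∫⁻ s, ‖V s‖ₑ) + ∫⁻ s, ‖V s‖ₑ := by
          rw [lintegral_add_left (by fun_prop),
            lintegral_sub_right_eq_self (fun s => ‖V s‖ₑ) (δ * y)]
  · rw [lintegral_mul_const'' _ hFi.1.enorm]
    exact ENNReal.mul_ne_top hFi.2.ne (ENNReal.add_ne_top.2 ⟨hVi.2.ne, hVi.2.ne⟩)
  · have h0 : Tendsto (fun δ : ℝ => δ * y) (𝓝 0) (𝓝 0) := by
      simpa using (continuous_id.mul_const y).tendsto (0 : ℝ)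
    simpa using ENNReal.Tendsto.const_mul (hVi.tendsto_lintegral_enorm_sub_translate.comp h0)
      (Or.inr (enorm_ne_top (x := F y)))

/-- Convolving `F` with a kernel concentrated in frequency near `ξ` is nearly multiplication by
`𝓕 F ξ`, uniformly in `ξ`. -/
theorem lintegral_enorm_convolution_modulatedDilation_sub_le {F V : ℝ → ℂ} (hF : Measurable F)
    (hFi : Integrable F) (hV : BandLimited V (-2) 2) (ξ : ℝ) {δ : ℝ} (hδ : 0 < δ) :
    ∫⁻ s, ‖(F ⋆ₘ modulatedDilation V ξ δ) s - 𝓕 F ξ * modulatedDilation V ξ δ s‖ₑ ≤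
      ∫⁻ y, ‖F y‖ₑ * ∫⁻ s, ‖V (s - δ * y) - V s‖ₑ := by
  have hVc := hV.continuous
  have hVm : Measurable V := hVc.measurable
  obtain ⟨M, hM⟩ := hV.exists_norm_le
  have hec := Real.continuous_fourierChar
  let k : ℝ → ℂ := fun y => 𝐞 (-(y * ξ)) • F y
  have hk : Integrable k := by
    simpa [k, mul_comm ξ] using (Real.fourierIntegral_convergent_iff ξ).2 hFi
  have hkV : ∀ s, Integrable fun y => k y * V (s - δ * y) := fun s => by
    have := hk.bdd_mul (f := fun y => V (s - δ * y)) (c := M)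
      (Continuous.aestronglyMeasurable (by fun_prop)) (ae_of_all _ fun y => hM _)
    simpa [mul_comm] using this
  have key : ∀ s, ‖(F ⋆ₘ modulatedDilation V ξ δ) s - 𝓕 F ξ * modulatedDilation V ξ δ s‖ₑ =
      ENNReal.ofReal δ * ‖∫ y, k y * (V (δ * s - δ * y) - V (δ * s))‖ₑ := by
    intro s
    have e1 : (F ⋆ₘ modulatedDilation V ξ δ) s - 𝓕 F ξ * modulatedDilation V ξ δ s =
        ((𝐞 (s * ξ) : Circle) : ℂ) * (δ * ∫ y, k y * (V (δ * s - δ * y) - V (δ * s))) := by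
      have e2 : ∫ y, k y * (V (δ * s - δ * y) - V (δ * s)) =
          (∫ y, k y * V (δ * s - δ * y)) - (∫ y, k y) * V (δ * s) := by
        simp only [mul_sub]
        rw [integral_sub (hkV _) (hk.mul_const _), integral_mul_const]
      have e3 : 𝓕 F ξ = ∫ y, k y := Real.fourier_real_eq F ξ
      have e4 : (F ⋆ₘ modulatedDilation V ξ δ) s =
          ((𝐞 (s * ξ) : Circle) : ℂ) * (δ * ∫ y, k y * V (δ * s - δ * y)) := by
        rw [mulConvolution_apply, ← integral_const_mul, ← integral_const_mul]
        congr 1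
        ext y
        have e5 : (s - y) * ξ = s * ξ + -(y * ξ) := by ring
        simp only [modulatedDilation, k, Circle.smul_def, smul_eq_mul]
        rw [e5, AddChar.map_add_eq_mul, Circle.coe_mul, mul_sub]
        ring
      rw [e2, e3, e4, modulatedDilation]
      ring
    rw [e1, enorm_mul, enorm_mul]
    have e6 : ‖((𝐞 (s * ξ) : Circle) : ℂ)‖ₑ = 1 := by
      rw [← ofReal_norm, Circle.norm_coe, ENNReal.ofReal_one]
    have e7 : ‖(δ : ℂ)‖ₑ = ENNReal.ofReal δ := by
      rw [← ofReal_norm, Complex.norm_real, Real.norm_of_nonneg hδ.le]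
    rw [e6, e7, one_mul]
  simp_rw [key]
  have hjoint : Measurable fun z : ℝ × ℝ => ‖V (z.1 - δ * z.2) - V z.1‖ₑ := by fun_prop
  have hscale : ∀ G : ℝ → ℝ≥0∞, Measurable G →
      ∫⁻ s, ENNReal.ofReal δ * G (δ * s) = ∫⁻ s, G s := by
    intro G hG
    rw [lintegral_const_mul' _ _ ENNReal.ofReal_ne_top,
      ← lintegral_map hG (measurable_const_mul δ),
      Real.map_volume_mul_left hδ.ne', lintegral_smul_measure, abs_of_pos (inv_pos.2 hδ),
      smul_eq_mul, ← mul_assoc, ← ENNReal.ofReal_mul hδ.le, mul_inv_cancel₀ hδ.ne',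
      ENNReal.ofReal_one, one_mul]
  calc ∫⁻ s, ENNReal.ofReal δ * ‖∫ y, k y * (V (δ * s - δ * y) - V (δ * s))‖ₑ
      ≤ ∫⁻ s, ENNReal.ofReal δ * ∫⁻ y, ‖F y‖ₑ * ‖V (δ * s - δ * y) - V (δ * s)‖ₑ := by
        refine lintegral_mono fun s => mul_le_mul_right ?_ _
        refine (enorm_integral_le_lintegral_enorm _).trans_eq (lintegral_congr fun y => ?_)
        rw [enorm_mul]
        congr 1
        rw [← ofReal_norm, ← ofReal_norm, Circle.norm_smul]
    _ = ∫⁻ s, ∫⁻ y, ‖F y‖ₑ * ‖V (s - δ * y) - V s‖ₑ :=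
        hscale (fun s => ∫⁻ y, ‖F y‖ₑ * ‖V (s - δ * y) - V s‖ₑ)
          (((hF.comp measurable_snd).enorm.mul hjoint).lintegral_prod_right')
    _ = ∫⁻ y, ∫⁻ s, ‖F y‖ₑ * ‖V (s - δ * y) - V s‖ₑ :=
        lintegral_lintegral_swap ((hF.comp measurable_snd).enorm.mul hjoint).aemeasurable
    _ = ∫⁻ y, ‖F y‖ₑ * ∫⁻ s, ‖V (s - δ * y) - V s‖ₑ := by
        simp_rw [lintegral_const_mul' _ _ enorm_ne_top]

theorem fourier_add_apply {g h : ℝ → ℂ} (hg : Integrable g) (hh : Integrable h) (η : ℝ) :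
    𝓕 (g + h) η = 𝓕 g η + 𝓕 h η :=
  congrFun (VectorFourier.fourierIntegral_add (L := innerₗ ℝ) Real.continuous_fourierChar
    (by exact continuous_inner) hg hh) η

theorem fourier_smul_apply (z : ℂ) (g : ℝ → ℂ) (η : ℝ) : 𝓕 (z • g) η = z * 𝓕 g η :=
  congrFun (VectorFourier.fourierIntegral_const_smul _ _ (innerₗ ℝ) g z) η

/-- If `F ⋆ W` is close in `L¹` to a nonzero multiple of `W`, then every function whose Fourier
transform lives where that of `W` equals one is approximable by translates of `F`. -/
theorem BandLimited.approximable_of_lintegral_le {Ψ : ℝ → ℝ} (hΨ : DoublingYoung Ψ)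
    {F W : ℝ → ℂ} (hF : Measurable F) (hFi : Integrable F) (hFfin : modular Ψ F < ∞)
    {a b a' b' ξ : ℝ} (hξ : 𝓕 F ξ ≠ 0) (hW : BandLimited W a' b')
    (hW₁ : ∀ η ∈ Icc a b, 𝓕 W η = 1)
    (hle : ∫⁻ s, ‖(F ⋆ₘ W) s - 𝓕 F ξ * W s‖ₑ ≤ ENNReal.ofReal (‖𝓕 F ξ‖ / 2))
    {φ : ℝ → ℂ} (hφ : BandLimited φ a b) : Approximable Ψ F φ := by
  set c := 𝓕 F ξ with hc
  let r : ℝ → ℂ := (F ⋆ₘ W) - c • W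
  let e : ℝ → ℂ := (-c⁻¹) • r
  have hFW := hW.convolution hFi
  have hri : Integrable r := hFW.integrable.sub (hW.integrable.smul c)
  have hei : Integrable e := hri.smul _
  have hc0 : 0 < ‖c‖ := norm_pos_iff.2 hξ
  have hemass : ∫⁻ y, ‖e y‖ₑ ≤ 2⁻¹ := by
    have h1 : ∀ y, ‖e y‖ₑ = ‖c⁻¹‖ₑ * ‖(F ⋆ₘ W) y - c * W y‖ₑ := by
      intro y
      simp [e, r, enorm_mul]
    simp_rw [h1]
    rw [lintegral_const_mul' _ _ enorm_ne_top]
    refine (mul_le_mul_right hle _).trans (le_of_eq ?_)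
    rw [← ofReal_norm, ← ENNReal.ofReal_mul (norm_nonneg _), norm_inv,
      show ‖c‖⁻¹ * (‖c‖ / 2) = 2⁻¹ by field_simp, ENNReal.ofReal_inv_of_pos two_pos,
      ENNReal.ofReal_ofNat]
  have hemass' : ∫ y, ‖e y‖ ≤ 1 := by
    rw [integral_norm_eq_lintegral_enorm hei.1]
    refine ENNReal.toReal_le_of_le_ofReal zero_le_one (hemass.trans ?_)
    simp
  have hshrink : ∀ ψ, BandLimited ψ a b → modular Ψ (e ⋆ₘ ψ) ≤ 2⁻¹ * modular Ψ ψ := by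
    intro ψ hψ
    have hm : Measurable fun p : ℝ × ℝ => ψ (p.1 - p.2) :=
      hψ.continuous.measurable.comp (measurable_fst.sub measurable_snd)
    refine (hΨ.modular_integral_le (H := fun s y => ψ (s - y)) hei hemass' hm).trans ?_
    simp_rw [DoublingYoung.modular_translate]
    rw [lintegral_mul_const'' _ hei.1.enorm]
    exact mul_le_mul_left hemass _
  have hsplit : ∀ ψ, BandLimited ψ a b → ψ = c⁻¹ • (ψ ⋆ₘ F) + e ⋆ₘ ψ := by
    intro ψ hψ
    rw [mulConvolution_comm ψ F]
    have hFψ := hψ.convolution hFi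
    have heψ := hψ.convolution hei
    have hft : 𝓕 (c⁻¹ • (F ⋆ₘ ψ) + e ⋆ₘ ψ) = 𝓕 ψ := by
      ext η
      have hsm : Integrable (c⁻¹ • (F ⋆ₘ ψ)) := hFψ.integrable.smul _
      have he : 𝓕 e η = -c⁻¹ * (𝓕 F η * 𝓕 W η - c * 𝓕 W η) := by
        have hr : r = (F ⋆ₘ W) + (-c) • W := by simp [r, sub_eq_add_neg]
        rw [fourier_smul_apply, hr, fourier_add_apply hFW.integrable (hW.integrable.smul _),
          fourier_smul_apply, Real.fourier_mul_convolution_eq hFi hW.integrable]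
        ring
      rw [fourier_add_apply hsm heψ.integrable, fourier_smul_apply,
        Real.fourier_mul_convolution_eq hFi hψ.integrable,
        Real.fourier_mul_convolution_eq hei hψ.integrable, he]
      by_cases h0 : 𝓕 ψ η = 0
      · simp [h0]
      · rw [hW₁ η (hψ.mem_Icc η h0)]
        field_simp
        ring
    refine hψ.eq_of_fourier_eq ⟨?_, ?_, ?_⟩ hft.symm
    · exact (hFψ.continuous.const_smul _).add heψ.continuous
    · exact (hFψ.integrable.smul _).add heψ.integrable
    · rw [hft]; exact hψ.mem_Icc
  have hiter : ∀ n : ℕ, ∀ ψ, BandLimited ψ a b → ∃ h, Measurable h ∧ Approximable Ψ F h ∧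
      modular Ψ (ψ - h) ≤ 2⁻¹ ^ n * modular Ψ ψ := by
    intro n
    induction n with
    | zero => exact fun ψ _ => ⟨0, measurable_const, .zero hΨ, by simp⟩
    | succ n ih =>
      intro ψ hψ
      obtain ⟨h, hm, hA, hn⟩ := ih _ (hψ.convolution hei)
      have hψF : Measurable (ψ ⋆ₘ F) := by
        rw [mulConvolution_comm]
        exact (hψ.convolution hFi).continuous.measurable
      have hψFA : Approximable Ψ F (ψ ⋆ₘ F) :=
        approximable_convolution hΨ hF hFi hFfin hψ.continuous.measurable hψ.integrable
      refine ⟨c⁻¹ • (ψ ⋆ₘ F) + h, (hψF.const_smul _).add hm,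
        .add hΨ hF (hψF.const_smul _) (.smul hΨ _ hψFA) hA, ?_⟩
      have hd : ψ - (c⁻¹ • (ψ ⋆ₘ F) + h) = e ⋆ₘ ψ - h := by
        rw [sub_add_eq_sub_sub]
        congr 1
        exact sub_eq_of_eq_add' (hsplit ψ hψ)
      rw [hd]
      refine hn.trans ((mul_le_mul_right (hshrink ψ hψ) _).trans (le_of_eq ?_))
      rw [pow_succ, mul_assoc]
  obtain ⟨M, hM⟩ := hφ.exists_norm_le
  have hfin : modular Ψ φ < ∞ := hΨ.modular_lt_top_of_norm_le hM hφ.integrable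
  have hlim : Tendsto (fun n : ℕ => (2⁻¹ : ℝ≥0∞) ^ n * modular Ψ φ) atTop (𝓝 0) := by
    simpa using ENNReal.Tendsto.mul_const
      (ENNReal.tendsto_pow_atTop_nhds_zero_of_lt_one ENNReal.one_half_lt_one)
      (Or.inr hfin.ne)
  refine .of_forall_exists hΨ hφ.continuous.measurable fun η hη => ?_
  obtain ⟨n, hn⟩ := (hlim.eventually (gt_mem_nhds (pos_iff_ne_zero.2 hη))).exists
  obtain ⟨h, hm, hA, hle⟩ := hiter n φ hφ
  exact ⟨h, hm, hA, hle.trans hn.le⟩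

/-- **Wiener's theorem for band-limited functions**: if the Fourier transform of `F` never
vanishes, every band-limited function is approximable by translates of `F`. -/
theorem BandLimited.approximable {Ψ : ℝ → ℝ} (hΨ : DoublingYoung Ψ) {F : ℝ → ℂ}
    (hF : Measurable F) (hFi : Integrable F) (hFfin : modular Ψ F < ∞) (hFT : ∀ ξ, 𝓕 F ξ ≠ 0)
    {φ : ℝ → ℂ} {A B : ℝ} (hφ : BandLimited φ A B) : Approximable Ψ F φ := by
  obtain ⟨V, hV, hV₁⟩ := exists_bandLimited_eq_one
  have hW₁ : ∀ ξ δ : ℝ, 0 < δ → ∀ η ∈ Icc (ξ - δ) (ξ + δ),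
      𝓕 (_root_.modulatedDilation V ξ δ) η = 1 := by
    intro ξ δ hδ η hη
    rw [fourier_modulatedDilation V ξ hδ]
    refine hV₁ _ ?_
    rw [abs_div, abs_of_pos hδ, div_le_one hδ, abs_le]
    constructor <;> linarith [hη.1, hη.2]
  obtain ⟨c, hc, hcle⟩ : ∃ c > 0, ∀ ξ ∈ Icc A (B + 1), c ≤ ‖𝓕 F ξ‖ := by
    rcases (Icc A (B + 1)).eq_empty_or_nonempty with he | hne
    · exact ⟨1, one_pos, by simp [he]⟩
    · obtain ⟨ξ, -, hmin⟩ := isCompact_Icc.exists_isMinOn hne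
        (continuous_fourier hFi).norm.continuousOn
      exact ⟨‖𝓕 F ξ‖, norm_pos_iff.2 (hFT ξ), fun η hη => hmin hη⟩
  obtain ⟨δ, ⟨hδ, hδ₁⟩, hδle⟩ : ∃ δ : ℝ, (0 < δ ∧ δ < 1) ∧
      ∫⁻ y, ‖F y‖ₑ * ∫⁻ s, ‖V (s - δ * y) - V s‖ₑ < ENNReal.ofReal (c / 2) := by
    have h1 := (tendsto_lintegral_enorm_mul_translate hF hFi hV.continuous.measurable
      hV.integrable).eventually (gt_mem_nhds (ENNReal.ofReal_pos.2 (half_pos hc)))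
    have h2 := h1.filter_mono (nhdsWithin_le_nhds (s := Ioi (0 : ℝ)))
    have h3 : ∀ᶠ δ : ℝ in 𝓝[>] 0, δ ∈ Ioo (0 : ℝ) 1 := Ioo_mem_nhdsGT one_pos
    exact (h3.and h2).exists
  have hlocal : ∀ ξ ∈ Icc A (B + 1), ∀ ψ, BandLimited ψ (ξ - δ) (ξ + δ) → Approximable Ψ F ψ :=
    fun ξ hξ ψ hψ => BandLimited.approximable_of_lintegral_le hΨ hF hFi hFfin (hFT ξ)
      (hV.modulatedDilation ξ hδ) (hW₁ ξ δ hδ)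
      ((lintegral_enorm_convolution_modulatedDilation_sub_le hF hFi hV ξ hδ).trans
        (hδle.le.trans (ENNReal.ofReal_le_ofReal (by linarith [hcle ξ hξ])))) hψ
  have hsweep : ∀ (n : ℕ) (a : ℝ), A ≤ a → a + n * (δ / 2) ≤ B + 1 →
      ∀ ψ, BandLimited ψ a (a + n * (δ / 2)) → Approximable Ψ F ψ := by
    intro n
    induction n with
    | zero =>
      intro a ha hb ψ hψ
      simp only [Nat.cast_zero, zero_mul, add_zero] at hb hψ
      exact hlocal a ⟨ha, hb⟩ ψ (hψ.mono (by linarith) (by linarith))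
    | succ n ih =>
      intro a ha hb ψ hψ
      push_cast at hb hψ
      have hn : 0 ≤ n * (δ / 2) := by positivity
      have hδ2 : 0 < δ / 2 := half_pos hδ
      set W := _root_.modulatedDilation V a (δ / 2)
      have hW : BandLimited W (a - 2 * (δ / 2)) (a + 2 * (δ / 2)) := hV.modulatedDilation a hδ2
      have hψW : BandLimited (ψ ⋆ₘ W) (a - δ) (a + δ) :=
        (hW.convolution hψ.integrable).mono (by linarith) (by linarith)
      have hrest : BandLimited (ψ - ψ ⋆ₘ W) (a + δ / 2) (a + δ / 2 + n * (δ / 2)) := by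
        refine ⟨hψ.continuous.sub hψW.continuous, hψ.integrable.sub hψW.integrable,
          fun η hη => ?_⟩
        have hft : 𝓕 (ψ - ψ ⋆ₘ W) η = 𝓕 ψ η * (1 - 𝓕 W η) := by
          have h1 : 𝓕 (ψ - ψ ⋆ₘ W) η = 𝓕 ψ η - 𝓕 (ψ ⋆ₘ W) η := by
            have h2 : 𝓕 ((ψ - ψ ⋆ₘ W) + ψ ⋆ₘ W) η = 𝓕 (ψ - ψ ⋆ₘ W) η + 𝓕 (ψ ⋆ₘ W) η :=
              fourier_add_apply (hψ.integrable.sub hψW.integrable) hψW.integrable η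
            rw [sub_add_cancel] at h2
            rw [h2, add_sub_cancel_right]
          rw [h1, Real.fourier_mul_convolution_eq hψ.integrable hW.integrable]
          ring
        rw [hft] at hη
        have hmem := hψ.mem_Icc η (left_ne_zero_of_mul hη)
        refine ⟨?_, by linarith [hmem.2]⟩
        by_contra! hlt
        refine right_ne_zero_of_mul hη ?_
        rw [hW₁ a (δ / 2) hδ2 η ⟨by linarith [hmem.1], hlt.le⟩, sub_self]
      have h1 := hlocal a ⟨ha, by linarith⟩ _ hψW
      have h2 := ih (a + δ / 2) (by linarith) (by linarith) _ hrest
      have h3 := Approximable.add hΨ hF hψW.continuous.measurable h1 h2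
      rwa [add_sub_cancel] at h3
  rcases lt_or_ge B A with hBA | hAB
  · have h0 : BandLimited (0 : ℝ → ℂ) A B := by
      refine ⟨continuous_const, integrable_zero _ _ _, fun ξ hξ => absurd ?_ hξ⟩
      simp [Real.fourier_real_eq]
    have : φ = 0 := hφ.eq_of_fourier_eq h0 <| by
      ext ξ
      rw [not_not.1 fun h => (Icc_eq_empty hBA.not_ge ▸ hφ.mem_Icc ξ h : ξ ∈ (∅ : Set ℝ)),
        not_not.1 fun h => (Icc_eq_empty hBA.not_ge ▸ h0.mem_Icc ξ h : ξ ∈ (∅ : Set ℝ))]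
    rw [this]
    exact .zero hΨ
  · have hδ2 : 0 < δ / 2 := half_pos hδ
    have h1 := Nat.le_ceil ((B - A) / (δ / 2))
    have h2 := Nat.ceil_lt_add_one (div_nonneg (sub_nonneg.2 hAB) hδ2.le)
    rw [div_le_iff₀ hδ2] at h1
    rw [← sub_lt_iff_lt_add, lt_div_iff₀ hδ2] at h2
    exact hsweep ⌈(B - A) / (δ / 2)⌉₊ A le_rfl (by linarith) φ (hφ.mono le_rfl (by linarith))

/-- Convolution with the dilates of `V` as averages over translates. -/
theorem modulatedDilation_zero_convolution (V u : ℝ → ℂ) {δ : ℝ} (hδ : 0 < δ) (s : ℝ) :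
    (modulatedDilation V 0 δ ⋆ₘ u) s = ∫ y, V y * u (s - y / δ) := by
  have h := Measure.integral_comp_mul_left (fun y => V y * u (s - y / δ)) δ
  rw [abs_of_pos (inv_pos.2 hδ), eq_inv_smul_iff₀ hδ.ne', ← integral_smul] at h
  rw [← h, mulConvolution_apply]
  congr 1
  ext y
  simp [modulatedDilation, mul_div_cancel_left₀ _ hδ.ne', mul_assoc]

theorem Approximable.of_integrable_bounded {Ψ : ℝ → ℝ} (hΨ : DoublingYoung Ψ) {F : ℝ → ℂ}
    (hF : Measurable F)
    (hFi : Integrable F) (hFfin : modular Ψ F < ∞) (hFT : ∀ ξ, 𝓕 F ξ ≠ 0)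
    {u : ℝ → ℂ} (hu : Measurable u) (hui : Integrable u) {M : ℝ} (hM : ∀ s, ‖u s‖ ≤ M) :
    Approximable Ψ F u := by
  obtain ⟨V, hV, hV₁⟩ := exists_bandLimited_eq_one
  have hVint : ∫ y, V y = 1 := by
    simpa [Real.fourier_real_eq] using hV₁ 0 (by simp)
  have hlim := hΨ.tendsto_modular_average_translate hu hui (hΨ.modular_lt_top_of_norm_le hM hui)
    hV.continuous.measurable hV.integrable (p := fun n y => y / ((n : ℝ) + 1)) (q := fun _ => 0)
    (fun n => by fun_prop) measurable_const fun y => by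
      simpa [div_eq_mul_inv] using
        (tendsto_one_div_add_atTop_nhds_zero_nat (𝕜 := ℝ)).const_mul y
  refine .of_forall_exists hΨ hu fun η hη => ?_
  obtain ⟨n, hn⟩ := (hlim.eventually (gt_mem_nhds (pos_iff_ne_zero.2 hη))).exists
  have hn₀ : (0 : ℝ) < n + 1 := by positivity
  have hg : BandLimited (u ⋆ₘ modulatedDilation V 0 (n + 1)) _ _ :=
    (hV.modulatedDilation 0 hn₀).convolution hui
  refine ⟨_, hg.continuous.measurable, hg.approximable hΨ hF hFi hFfin hFT,
    le_of_eq_of_le ?_ hn.le⟩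
  unfold modular
  congr 1
  ext s
  rw [mulConvolution_comm, Pi.sub_apply, modulatedDilation_zero_convolution V u hn₀, norm_sub_rev]
  simp [integral_mul_const, hVint]

/-- **Wiener's approximation theorem** in Orlicz spaces, for the modular. -/
theorem Approximable.of_modular_lt_top {Ψ : ℝ → ℝ} (hΨ : DoublingYoung Ψ) {F : ℝ → ℂ}
    (hF : Measurable F)
    (hFi : Integrable F) (hFfin : modular Ψ F < ∞) (hFT : ∀ ξ, 𝓕 F ξ ≠ 0)
    {G : ℝ → ℂ} (hG : Measurable G) (hGfin : modular Ψ G < ∞) : Approximable Ψ F G := by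
  refine .of_forall_exists hΨ hG fun η hη => ?_
  obtain ⟨u, hu, hui, ⟨M, hM⟩, hlt⟩ := hΨ.exists_bounded_modular_sub_lt hG hGfin hη
  exact ⟨u, hu, .of_integrable_bounded hΨ hF hFi hFfin hFT hu hui hM, hlt.le⟩

theorem fourier_ofReal_comp_neg (f : ℝ → ℝ) (ξ : ℝ) :
    𝓕 (fun s => (f (-s) : ℂ)) ξ =
      ∫ s : ℝ, Complex.exp (-2 * Real.pi * Complex.I * ((-ξ : ℝ) : ℂ) * s) * (f s : ℂ) := by
  rw [Real.fourier_real_eq_integral_exp_smul, ← integral_neg_eq_self]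
  congr 1
  ext s
  rw [smul_eq_mul, neg_neg]
  congr 2
  push_cast
  ring

/-- Theorem 3.2 of the paper.
Let `Ψ` be a finite-valued Young function satisfying the Δ₂-condition.  If
`f ∈ L_Ψ ∩ L¹(ℝ)` has non-vanishing Fourier transform, then the linear span of
the translated reflections `s ↦ f (t - s)`, `t ∈ ℝ`, is dense in `L_Ψ` for the
Luxemburg norm. -/
theorem invertibility_density_in_orlicz
    (Ψ : ℝ → ℝ)
    (hΨ_nonneg : ∀ x, 0 ≤ Ψ x)
    (hΨ_even : ∀ x, Ψ (-x) = Ψ x)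
    (hΨ_convex : ConvexOn ℝ Set.univ Ψ)
    (hΨ_zero : ∀ x, Ψ x = 0 ↔ x = 0)
    (hΨ_Δ₂ : ∃ K > 0, ∀ x ≥ 0, Ψ (2 * x) ≤ K * Ψ x)
    (f : ℝ → ℝ) (hf_meas : Measurable f)
    (hf_Orlicz : ∫⁻ s, ENNReal.ofReal (Ψ |f s|) < ⊤)
    (hf_L1 : Integrable f)
    (hf_FT : ∀ ξ : ℝ,
      (∫ s : ℝ, Complex.exp (-2 * Real.pi * Complex.I * ξ * s) * (f s : ℂ)) ≠ 0)
    (g : ℝ → ℝ) (hg_meas : Measurable g)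
    (hg_Orlicz : ∫⁻ s, ENNReal.ofReal (Ψ |g s|) < ⊤)
    (ε : ℝ) (hε : 0 < ε) :
    ∃ (n : ℕ) (θ : Fin n → ℝ) (t : Fin n → ℝ),
      sInf {a : ℝ | 0 < a ∧
          ∫⁻ s, ENNReal.ofReal (Ψ (|g s - ∑ j, θ j * f (t j - s)| / a)) ≤ 1} < ε := by
  have hΨ : DoublingYoung Ψ := ⟨hΨ_nonneg, (hΨ_zero 0).2 rfl, hΨ_convex, hΨ_Δ₂⟩
  let F : ℝ → ℂ := fun s => (f (-s) : ℂ)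
  let G : ℝ → ℂ := fun s => (g s : ℂ)
  have hF : Measurable F := by fun_prop
  have hG : Measurable G := by fun_prop
  have hFi : Integrable F := hf_L1.comp_neg.ofReal
  have hFfin : modular Ψ F < ∞ := by
    have h := lintegral_neg_eq_self (μ := (volume : Measure ℝ))
      fun s => ENNReal.ofReal (Ψ |f s|)
    simpa [modular, F, h] using hf_Orlicz
  have hGfin : modular Ψ G < ∞ := by simpa [modular, G] using hg_Orlicz
  have hFT : ∀ ξ, 𝓕 F ξ ≠ 0 := fun ξ => by
    rw [fourier_ofReal_comp_neg]
    exact hf_FT (-ξ)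
  have hε2 : 0 < ε / 2 := half_pos hε
  obtain ⟨C, hC, hsmul⟩ := hΨ.exists_modular_smul_le (((ε / 2)⁻¹ : ℝ) : ℂ)
  obtain ⟨η, hη, hη₁⟩ := ENNReal.exists_pos_mul_le hC one_ne_zero
  obtain ⟨p, hp, hpη⟩ :=
    Approximable.of_modular_lt_top hΨ hF hFi hFfin hFT hG hGfin η hη
  obtain ⟨n, c, x, rfl⟩ := Submodule.mem_span_set'.1 hp
  choose t ht using fun j => (x j).2
  refine ⟨n, fun j => (c j).re, t, lt_of_le_of_lt (csInf_le ⟨0, fun a ha => ha.1.le⟩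
    ⟨hε2, le_trans (lintegral_mono fun s => ?_)
      ((hsmul _).trans ((mul_le_mul_right hpη.le C).trans hη₁))⟩) (half_lt_self hε)⟩
  refine ENNReal.ofReal_le_ofReal (hΨ.mono (by positivity) ?_)
  have hre : g s - ∑ j, (c j).re * f (t j - s) = ((G - ∑ j, c j • (x j : ℝ → ℂ)) s).re := by
    simp [← ht, F, G, Finset.sum_apply]
  rw [hre, Pi.smul_apply, norm_smul, Complex.norm_real, norm_of_nonneg (inv_pos.2 hε2).le,
    div_eq_inv_mul]
  exact mul_le_mul_of_nonneg_left (Complex.abs_re_le_norm _) (inv_pos.2 hε2).le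
end

section
/- Let Ψ : ℝ → [0,∞) be a finite-valued Young function satisfying the Δ₂-condition and let Ψ̄(x) := sup_{y ≥ 0}(|x|y − Ψ(y)) denote its complementary function. Let f ∈ L¹(ℝ) be such that ∫_ℝ e^{-2πiξs} f(s) ds ≠ 0 for every ξ ∈ ℝ, and let g : ℝ → ℝ be measurable with ∫_ℝ Ψ̄(|g(s)|) ds < ∞. If for every t ∈ ℝ the integral ∫_ℝ f(t − s) g(s) ds converges absolutely and equals 0, then g = 0 Lebesgue-almost everywhere. -/
open MeasureTheory Real Set

open Filter Topology SchwartzMap FourierTransform ContDiff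

lemma fourierInv_comp_sub_div (χ : ℝ → ℂ) (a : ℝ) {c : ℝ} (hc : 0 < c) (x : ℝ) :
    𝓕⁻ (fun ξ ↦ χ ((ξ - a) / c)) x = 𝐞 (a * x) * (c * 𝓕⁻ χ (c * x)) := by
  let G : ℝ → ℂ := fun u ↦ 𝐞 ((c * u + a) * x) * χ u
  have h : ∀ ξ : ℝ, 𝐞 (inner ℝ ξ x) • χ ((ξ - a) / c) = G ((ξ - a) / c) := by
    intro ξ
    have : (c * ((ξ - a) / c) + a) * x = inner ℝ ξ x := by
      rw [mul_div_cancel₀ _ hc.ne']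
      simp [mul_comm]
    simp only [G, this, Circle.smul_def, smul_eq_mul]
  rw [Real.fourierInv_eq, Real.fourierInv_eq]
  simp_rw [h]
  rw [integral_sub_right_eq_self (fun ξ ↦ G (ξ / c)) a, Measure.integral_comp_div, abs_of_pos hc,
    ← integral_const_mul, ← integral_const_mul, ← integral_smul]
  congr 1
  ext u
  have : (c * u + a) * x = a * x + inner ℝ u (c * x) := by
    simp; ring
  simp only [G, this, AddChar.map_add_eq_mul, Circle.coe_mul, Circle.smul_def, smul_eq_mul,
    Complex.real_smul]
  ring

lemma SchwartzMap.exists_norm_comp_sub_le (V : 𝓢(ℝ, ℂ)) :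
    ∃ C, 0 ≤ C ∧ ∀ x a : ℝ, ‖V (x - a)‖ ≤ C * (1 + |a|) ^ 2 * (1 + ‖x‖) ^ (-2 : ℝ) := by
  refine ⟨2 ^ 2 * (Finset.Iic (2, 0)).sup (fun m ↦ SchwartzMap.seminorm ℝ m.1 m.2) V,
    by positivity, fun x a ↦ ?_⟩
  have h := V.one_add_le_sup_seminorm_apply (𝕜 := ℝ) (m := (2, 0)) (k := 2) (n := 0) le_rfl le_rfl
    (x - a)
  simp only [norm_iteratedFDeriv_zero] at h
  rw [Real.rpow_neg (by positivity), ← div_eq_mul_inv, le_div_iff₀ (by positivity)]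
  norm_cast
  have h1 : 1 + ‖x‖ ≤ (1 + |a|) * (1 + ‖x - a‖) := by
    have := abs_add_le (x - a) a
    simp only [sub_add_cancel] at this
    simp only [Real.norm_eq_abs]
    nlinarith [abs_nonneg (x - a), abs_nonneg a]
  calc ‖V (x - a)‖ * (1 + ‖x‖) ^ 2
      ≤ ‖V (x - a)‖ * ((1 + |a|) * (1 + ‖x - a‖)) ^ 2 := by gcongr
    _ = ((1 + ‖x - a‖) ^ 2 * ‖V (x - a)‖) * (1 + |a|) ^ 2 := by ring
    _ ≤ _ := mul_le_mul_of_nonneg_right (mod_cast h) (by positivity)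

/-- The modulus of continuity of a Schwartz function in `L¹`. -/
noncomputable def SchwartzMap.modulus (V : 𝓢(ℝ, ℂ)) (a : ℝ) : ℝ := ∫ x, ‖V x - V (x - a)‖

lemma SchwartzMap.integrable_norm_sub (V : 𝓢(ℝ, ℂ)) (a : ℝ) :
    Integrable fun x ↦ ‖V x - V (x - a)‖ :=
  (V.integrable.sub (V.integrable.comp_sub_right a)).norm

lemma SchwartzMap.modulus_zero (V : 𝓢(ℝ, ℂ)) : V.modulus 0 = 0 := by
  simp [SchwartzMap.modulus]

lemma SchwartzMap.modulus_nonneg (V : 𝓢(ℝ, ℂ)) (a : ℝ) : 0 ≤ V.modulus a :=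
  integral_nonneg fun _ ↦ norm_nonneg _

lemma SchwartzMap.modulus_le (V : 𝓢(ℝ, ℂ)) (a : ℝ) : V.modulus a ≤ 2 * ∫ x, ‖V x‖ := by
  have h : Integrable fun x ↦ ‖V x‖ := V.integrable.norm
  calc V.modulus a ≤ ∫ x, (‖V x‖ + ‖V (x - a)‖) :=
        integral_mono (V.integrable_norm_sub a) (h.add (h.comp_sub_right a)) fun x ↦ norm_sub_le _ _
    _ = 2 * ∫ x, ‖V x‖ := by
        rw [integral_add h (h.comp_sub_right a), integral_sub_right_eq_self (fun x ↦ ‖V x‖) a]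
        ring

lemma SchwartzMap.continuous_modulus (V : 𝓢(ℝ, ℂ)) : Continuous V.modulus := by
  obtain ⟨C, hC, hV⟩ := V.exists_norm_comp_sub_le
  refine continuous_iff_continuousAt.2 fun a₀ ↦ ?_
  refine continuousAt_of_dominated (F := fun a x ↦ ‖V x - V (x - a)‖)
    (bound := fun x ↦ ‖V x‖ + C * (1 + (|a₀| + 1)) ^ 2 * (1 + ‖x‖) ^ (-2 : ℝ))
    (Eventually.of_forall fun a ↦ (V.integrable_norm_sub a).aestronglyMeasurable) ?_ ?_ ?_
  · have : ∀ᶠ a in 𝓝 a₀, |a| < |a₀| + 1 :=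
      continuous_abs.continuousAt.eventually_lt continuousAt_const (lt_add_one _)
    filter_upwards [this] with a ha
    refine Eventually.of_forall fun x ↦ ?_
    rw [norm_norm]
    refine (norm_sub_le _ _).trans (add_le_add_right ((hV x a).trans ?_) _)
    gcongr
  · exact V.integrable.norm.add ((integrable_one_add_norm (by simp)).const_mul _)
  · exact Eventually.of_forall fun x ↦ by fun_prop

lemma exists_integral_norm_mul_modulus_lt {f : ℝ → ℂ} (hf : Integrable f) (V : 𝓢(ℝ, ℂ)) {m : ℝ}
    (hm : 0 < m) : ∃ c > 0, ∫ y, ‖f y‖ * V.modulus (c * y) < m := by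
  have h : Tendsto (fun c ↦ ∫ y, ‖f y‖ * V.modulus (c * y)) (𝓝[>] 0) (𝓝 (∫ y, ‖f y‖ * 0)) := by
    refine tendsto_integral_filter_of_dominated_convergence
      (fun y ↦ ‖f y‖ * (2 * ∫ x, ‖V x‖)) ?_ ?_ (hf.norm.mul_const _) ?_
    · refine Eventually.of_forall fun c ↦ hf.norm.aestronglyMeasurable.mul ?_
      exact (V.continuous_modulus.comp (continuous_const_mul c)).aestronglyMeasurable
    · refine Eventually.of_forall fun c ↦ Eventually.of_forall fun y ↦ ?_
      rw [norm_mul, norm_norm, Real.norm_of_nonneg (V.modulus_nonneg _)]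
      gcongr
      exact V.modulus_le _
    · refine Eventually.of_forall fun y ↦ Tendsto.const_mul _ ?_
      have : Continuous fun c ↦ V.modulus (c * y) :=
        V.continuous_modulus.comp (continuous_mul_const y)
      have := (this.tendsto 0).mono_left (nhdsWithin_le_nhds (s := Ioi 0))
      simpa [V.modulus_zero] using this
  simp only [mul_zero, integral_zero] at h
  obtain ⟨c, hc, hc'⟩ := ((h.eventually_lt_const hm).and self_mem_nhdsWithin).exists
  exact ⟨c, hc', hc⟩

/-- If `v` is a bounded function with `f * v = 0` whose increments are dominated by
`B y * ‖v‖_∞`, where `∫ ‖f‖ B < |∫ f|`, then `v = 0`. -/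
lemma eq_zero_of_integral_mul_sub_eq_zero {f v : ℝ → ℂ} {B : ℝ → ℝ} (hf : Integrable f)
    (hfB : Integrable fun y ↦ ‖f y‖ * B y) (hlt : ∫ y, ‖f y‖ * B y < ‖∫ y, f y‖)
    (hvc : Continuous v) {M : ℝ} (hvM : ∀ x, ‖v x‖ ≤ M)
    (hv : ∀ A, (∀ x, ‖v x‖ ≤ A) → ∀ x y, ‖v x - v (x - y)‖ ≤ A * B y)
    (hfv : ∀ x, ∫ y, f y * v (x - y) = 0) (x : ℝ) : v x = 0 := by
  have hbdd : BddAbove (range fun x ↦ ‖v x‖) := ⟨M, by rintro _ ⟨x, rfl⟩; exact hvM x⟩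
  set A := ⨆ x, ‖v x‖ with hA
  have hvA : ∀ x, ‖v x‖ ≤ A := fun x ↦ le_ciSup hbdd x
  have key : ∀ x, ‖v x‖ * ‖∫ y, f y‖ ≤ A * ∫ y, ‖f y‖ * B y := by
    intro x
    have h1 : Integrable fun y ↦ f y * v (x - y) :=
      hf.mul_bdd (c := M) (hvc.comp (continuous_const.sub continuous_id)).aestronglyMeasurable
        (Eventually.of_forall fun y ↦ hvM _)
    have h2 : v x * ∫ y, f y = ∫ y, f y * (v x - v (x - y)) := by
      simp_rw [mul_sub]
      rw [integral_sub (hf.mul_const _) h1, hfv, integral_mul_const, sub_zero, mul_comm]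
    rw [← norm_mul, h2, ← integral_const_mul]
    refine norm_integral_le_of_norm_le (hfB.const_mul A) (Eventually.of_forall fun y ↦ ?_)
    rw [norm_mul]
    calc ‖f y‖ * ‖v x - v (x - y)‖ ≤ ‖f y‖ * (A * B y) := by gcongr; exact hv A hvA x y
      _ = _ := by ring
  have hpos : 0 ≤ A := (norm_nonneg _).trans (hvA 0)
  have hF : 0 ≤ ‖∫ y, f y‖ := norm_nonneg _
  have hA0 : A ≤ 0 := by
    by_contra! hA'
    have hI : 0 < ‖∫ y, f y‖ := by
      refine hF.lt_of_ne fun h0 ↦ ?_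
      have := key 0
      rw [← h0, mul_zero] at this
      have h3 := mul_neg_of_pos_of_neg hA' (h0 ▸ hlt)
      linarith
    have : A ≤ (A * ∫ y, ‖f y‖ * B y) / ‖∫ y, f y‖ :=
      ciSup_le fun x ↦ (le_div_iff₀ hI).2 (key x)
    rw [le_div_iff₀ hI] at this
    exact absurd (le_of_mul_le_mul_left this hA') hlt.not_ge
  exact norm_le_zero_iff.1 ((hvA x).trans hA0)

lemma integral_mul_integral_mul_comm {f φ h : ℝ → ℂ} {t : ℝ}
    (hint : Integrable fun p : ℝ × ℝ ↦ f p.1 * (φ p.2 * h (t - p.1 - p.2))) :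
    ∫ s, f s * ∫ r, φ r * h (t - s - r) = ∫ r, φ r * ∫ s, f s * h (t - r - s) := by
  simp_rw [← integral_const_mul]
  rw [integral_integral_swap hint]
  refine integral_congr_ae (Eventually.of_forall fun r ↦ integral_congr_ae
    (Eventually.of_forall fun s ↦ ?_))
  simp only [sub_right_comm t s r]
  ring

lemma integrable_mul_mul_of_bounded {f φ h : ℝ → ℂ} (hf : Integrable f) (hφ : Integrable φ)
    (hh : Measurable h) {M : ℝ} (hM : ∀ x, ‖h x‖ ≤ M) (t : ℝ) :
    Integrable fun p : ℝ × ℝ ↦ f p.1 * (φ p.2 * h (t - p.1 - p.2)) := by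
  simp_rw [← mul_assoc]
  exact (hf.mul_prod hφ).mul_bdd (c := M)
    (hh.comp (g := h) (f := fun p : ℝ × ℝ ↦ t - p.1 - p.2) (by fun_prop)).aestronglyMeasurable
    (Eventually.of_forall fun p ↦ hM _)

lemma continuous_integral_mul_sub {f h : ℝ → ℂ} (hf : Integrable f) (hh : Continuous h) {M : ℝ}
    (hM : ∀ x, ‖h x‖ ≤ M) : Continuous fun x ↦ ∫ s, f s * h (x - s) :=
  BddAbove.continuous_convolution_right_of_integrable (ContinuousLinearMap.mul ℂ ℂ)
    ⟨M, by rintro _ ⟨x, rfl⟩; exact hM x⟩ hf hh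

lemma norm_integral_mul_sub_le {f h : ℝ → ℂ} (hf : Integrable f) {M : ℝ} (hM : ∀ x, ‖h x‖ ≤ M)
    (x : ℝ) : ‖∫ s, f s * h (x - s)‖ ≤ (∫ s, ‖f s‖) * M := by
  rw [← integral_mul_const]
  refine norm_integral_le_of_norm_le (hf.norm.mul_const M) (Eventually.of_forall fun s ↦ ?_)
  rw [norm_mul]
  gcongr
  exact hM _

lemma integral_mul_integral_mul_assoc {u φ h : ℝ → ℂ} (hu : Integrable u) (hφ : Integrable φ)
    (hh : Continuous h) {M : ℝ} (hM : ∀ x, ‖h x‖ ≤ M) (x : ℝ) :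
    ∫ s, u s * ∫ r, φ r * h (x - s - r) = ∫ r, (∫ s, u s * φ (r - s)) * h (x - r) := by
  have h1 : ∀ s, ∫ r, φ r * h (x - s - r) = ∫ r, φ (r - s) * h (x - r) := fun s ↦ by
    rw [← integral_sub_right_eq_self _ s]
    simp only [sub_sub, add_sub_cancel]
  have hint : Integrable fun p : ℝ × ℝ ↦ u p.2 * φ (p.1 - p.2) * h (x - p.1) :=
    (hu.convolution_integrand (ContinuousLinearMap.mul ℂ ℂ) hφ).mul_bdd (c := M)
      (hh.comp (continuous_const.sub continuous_fst)).aestronglyMeasurable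
      (Eventually.of_forall fun p ↦ hM _)
  simp_rw [h1, ← integral_const_mul, ← integral_mul_const, ← mul_assoc]
  exact (integral_integral_swap hint).symm

lemma SchwartzMap.fourierInv_eq_integral_mul {χ ψ : 𝓢(ℝ, ℂ)} (h : ∀ ξ, χ ξ * ψ ξ = ψ ξ) (x : ℝ) :
    ∫ s, (𝓕⁻ χ) s * (𝓕⁻ ψ) (x - s) = (𝓕⁻ ψ) x := by
  have h1 : SchwartzMap.convolution (ContinuousLinearMap.mul ℂ ℂ) (𝓕⁻ χ) (𝓕⁻ ψ) = 𝓕⁻ ψ := by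
    rw [← FourierTransform.fourierInv_fourier_eq (F := 𝓢(ℝ, ℂ))
        (SchwartzMap.convolution (ContinuousLinearMap.mul ℂ ℂ) (𝓕⁻ χ) (𝓕⁻ ψ)),
      SchwartzMap.fourier_convolution]
    congr 1
    ext ξ
    simp [h ξ]
  rw [← congrArg (fun φ : 𝓢(ℝ, ℂ) ↦ φ x) h1, SchwartzMap.convolution_apply]
  rfl

/-- A smooth function equal to `1` on `[-1, 1]` and supported in `[-2, 2]`. -/
noncomputable def cutoff : ContDiffBump (0 : ℝ) := ⟨1, 2, one_pos, one_lt_two⟩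

/-- The function `ξ ↦ cutoff ((ξ - a) / c)` as a Schwartz function. -/
noncomputable def cutoffAt (a : ℝ) {c : ℝ} (hc : 0 < c) : 𝓢(ℝ, ℂ) :=
  HasCompactSupport.toSchwartzMap (f := fun ξ ↦ (cutoff ((ξ - a) / c) : ℂ))
    (HasCompactSupport.intro (isCompact_Icc (a := a - 2 * c) (b := a + 2 * c)) fun ξ hξ ↦ by
      rw [Complex.ofReal_eq_zero]
      refine cutoff.zero_of_le_dist ?_
      by_contra! hlt
      rw [dist_zero_right, Real.norm_eq_abs, abs_div, abs_of_pos hc, div_lt_iff₀ hc] at hlt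
      have := abs_lt.1 hlt
      simp only [cutoff] at this
      exact hξ ⟨by linarith, by linarith⟩)
    (Complex.ofRealCLM.contDiff.comp (cutoff.contDiff.comp (by fun_prop)))

lemma cutoffAt_apply (a : ℝ) {c : ℝ} (hc : 0 < c) (ξ : ℝ) :
    cutoffAt a hc ξ = cutoff ((ξ - a) / c) := rfl

lemma cutoffAt_eq_one {a c : ℝ} (hc : 0 < c) {ξ : ℝ} (hξ : |ξ - a| ≤ c) : cutoffAt a hc ξ = 1 := by
  rw [cutoffAt_apply, Complex.ofReal_eq_one]
  refine cutoff.one_of_mem_closedBall ?_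
  rw [mem_closedBall_zero_iff, Real.norm_eq_abs, abs_div, abs_of_pos hc]
  exact div_le_one_of_le₀ hξ hc.le

/-- The inverse Fourier transform of `cutoffAt`. -/
noncomputable def cutoffKernel (a : ℝ) {c : ℝ} (hc : 0 < c) : 𝓢(ℝ, ℂ) := 𝓕⁻ (cutoffAt a hc)

lemma cutoffKernel_apply (a : ℝ) {c : ℝ} (hc : 0 < c) (x : ℝ) :
    cutoffKernel a hc x = (𝐞 (a * x) : ℂ) * ((c : ℂ) * cutoffKernel 0 one_pos (c * x)) := by
  rw [cutoffKernel, cutoffKernel, SchwartzMap.fourierInv_coe, SchwartzMap.fourierInv_coe]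
  have h : (cutoffAt 0 one_pos : ℝ → ℂ) = fun ξ ↦ (cutoff ξ : ℂ) := by
    ext ξ
    simp [cutoffAt_apply]
  rw [h]
  exact fourierInv_comp_sub_div (fun ξ ↦ (cutoff ξ : ℂ)) a hc x

lemma norm_cutoffKernel_sub_le {v : ℝ → ℂ} (hv : Continuous v) {A : ℝ}
    (hA : ∀ x, ‖v x‖ ≤ A) {c : ℝ} (hc : 0 < c)
    (hrep : ∀ x, v x = ∫ s, cutoffKernel 0 hc s * v (x - s)) (x y : ℝ) :
    ‖v x - v (x - y)‖ ≤ A * (cutoffKernel 0 one_pos).modulus (c * y) := by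
  set V : 𝓢(ℝ, ℂ) := cutoffKernel 0 one_pos
  set W : 𝓢(ℝ, ℂ) := cutoffKernel 0 hc with hW
  have hWV : ∀ s, W s = c * V (c * s) := fun s ↦ by simp [hW, cutoffKernel_apply 0 hc s, V]
  have hvx : AEStronglyMeasurable (fun s ↦ v (x - s)) :=
    (hv.comp (continuous_const.sub continuous_id)).aestronglyMeasurable
  have hshift : v (x - y) = ∫ s, W (s - y) * v (x - s) := by
    rw [hrep, ← integral_sub_right_eq_self _ y]
    simp only [sub_sub, add_sub_cancel]
  have hW1 : Integrable W := W.integrable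
  have hW2 := hW1.comp_sub_right y
  have hmod : V.modulus (c * y) = ∫ s, ‖W s - W (s - y)‖ := by
    have h : ∀ s, ‖W s - W (s - y)‖ = c * ‖V (c * s) - V (c * s - c * y)‖ := fun s ↦ by
      rw [hWV, hWV, ← mul_sub, norm_mul, mul_sub, Complex.norm_real, Real.norm_of_nonneg hc.le]
    simp_rw [h]
    rw [integral_const_mul, Measure.integral_comp_mul_left (fun s ↦ ‖V s - V (s - c * y)‖) c,
      abs_of_pos (inv_pos.2 hc), smul_eq_mul, mul_inv_cancel_left₀ hc.ne']
    rfl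
  rw [hshift, hrep x, ← integral_sub (hW1.mul_bdd hvx (Eventually.of_forall fun s ↦ hA _))
    (hW2.mul_bdd hvx (Eventually.of_forall fun s ↦ hA _)), hmod, ← integral_const_mul]
  refine norm_integral_le_of_norm_le ((hW1.sub hW2).norm.const_mul A)
    (Eventually.of_forall fun s ↦ ?_)
  rw [← sub_mul, norm_mul, mul_comm]
  gcongr
  exact hA _

lemma integral_fourierInv_mul_eq_zero_of_support_subset {f h : ℝ → ℂ} (hf : Integrable f)
    (hh : Continuous h) {M : ℝ} (hM : ∀ x, ‖h x‖ ≤ M) (hfh : ∀ t, ∫ s, f s * h (t - s) = 0)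
    {a c : ℝ} (hc : 0 < c)
    (hlt : ∫ y, ‖f y‖ * (cutoffKernel 0 one_pos).modulus (c * y) < ‖𝓕 f a‖)
    {ψ : 𝓢(ℝ, ℂ)} (hψ : ∀ ξ, ψ ξ ≠ 0 → |ξ - a| ≤ c) (x : ℝ) :
    ∫ s, (𝓕⁻ ψ) s * h (x - s) = 0 := by
  set V : 𝓢(ℝ, ℂ) := cutoffKernel 0 one_pos
  have hφ : Integrable (𝓕⁻ ψ : 𝓢(ℝ, ℂ)) := (𝓕⁻ ψ).integrable
  have hU : Integrable (cutoffKernel a hc) := (cutoffKernel a hc).integrable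
  set w : ℝ → ℂ := fun x ↦ ∫ s, (𝓕⁻ ψ) s * h (x - s) with hw
  have hwc : Continuous w := continuous_integral_mul_sub hφ hh hM
  have hwM := norm_integral_mul_sub_le hφ hM
  have hfw : ∀ t, ∫ s, f s * w (t - s) = 0 := fun t ↦ by
    rw [hw, integral_mul_integral_mul_comm
      (integrable_mul_mul_of_bounded hf hφ hh.measurable hM t)]
    simp [hfh]
  have hrep : ∀ x, ∫ s, cutoffKernel a hc s * w (x - s) = w x := fun x ↦ by
    rw [hw, integral_mul_integral_mul_assoc hU hφ hh hM]
    congr with r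
    rw [cutoffKernel, SchwartzMap.fourierInv_eq_integral_mul]
    intro ξ
    by_cases h0 : ψ ξ = 0
    · simp [h0]
    · rw [cutoffAt_eq_one hc (hψ ξ h0), one_mul]
  let e : ℝ → ℂ := fun x ↦ 𝐞 (-(a * x))
  have he : Continuous e :=
    continuous_subtype_val.comp (continuous_fourierChar.comp (by fun_prop))
  have hen : ∀ x, ‖e x‖ = 1 := fun x ↦ Circle.norm_coe _
  have headd : ∀ x y, e (x - y) * e y = e x := fun x y ↦ by
    simp only [e, ← Circle.coe_mul, ← AddChar.map_add_eq_mul]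
    congr 3
    ring
  let v : ℝ → ℂ := fun x ↦ e x * w x
  have hvc : Continuous v := he.mul hwc
  have hvn : ∀ x, ‖v x‖ = ‖w x‖ := fun x ↦ by simp [v, hen]
  have hvrep : ∀ x, v x = ∫ s, cutoffKernel 0 hc s * v (x - s) := fun x ↦ by
    simp only [v]
    rw [← hrep x, ← integral_const_mul]
    congr with s
    have h1 : e s * (𝐞 (a * s) : ℂ) = 1 := by
      simp only [e, ← Circle.coe_mul, ← AddChar.map_add_eq_mul]
      simp
    rw [cutoffKernel_apply a hc, cutoffKernel_apply 0 hc, ← headd x s]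
    simp only [zero_mul, AddChar.map_zero_eq_one, Circle.coe_one, one_mul]
    linear_combination (e (x - s) * (c * V (c * s)) * w (x - s)) * h1
  have hint : Integrable fun y ↦ e y * f y :=
    hf.bdd_mul he.aestronglyMeasurable (Eventually.of_forall fun y ↦ (hen y).le)
  have hFa : ∫ y, e y * f y = 𝓕 f a := by
    rw [Real.fourier_real_eq]
    simp [e, mul_comm a, Circle.smul_def]
  have hnorm : ∀ y, ‖e y * f y‖ = ‖f y‖ := fun y ↦ by simp [hen]
  have hv0 : v x = 0 := by
    refine eq_zero_of_integral_mul_sub_eq_zero (f := fun y ↦ e y * f y)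
      (B := fun y ↦ V.modulus (c * y)) hint ?_ ?_ hvc (fun x ↦ (hvn x).trans_le (hwM x)) ?_ ?_ x
    · refine hint.norm.mul_bdd (c := 2 * ∫ x, ‖V x‖)
        (V.continuous_modulus.comp (continuous_const_mul c)).aestronglyMeasurable
        (Eventually.of_forall fun y ↦ ?_)
      rw [Real.norm_of_nonneg (V.modulus_nonneg _)]
      exact V.modulus_le _
    · simpa only [hFa, hnorm] using hlt
    · exact fun A hA x y ↦ norm_cutoffKernel_sub_le hvc hA hc hvrep x y
    · intro x
      have : ∀ y, e y * f y * v (x - y) = e x * (f y * w (x - y)) := fun y ↦ by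
        simp only [v]
        linear_combination f y * w (x - y) * headd x y
      simp_rw [this]
      rw [integral_const_mul, hfw, mul_zero]
  rw [← norm_eq_zero, ← hvn x, hv0, norm_zero]

lemma SchwartzMap.induction_on_support {P : 𝓢(ℝ, ℂ) → Prop}
    (hadd : ∀ ψ₁ ψ₂, P ψ₁ → P ψ₂ → P (ψ₁ + ψ₂)) {a b c : ℝ} (hc : 0 < c)
    (hP : ∀ ξ₀ ∈ Icc a b, ∀ ψ : 𝓢(ℝ, ℂ), (∀ ξ, ψ ξ ≠ 0 → |ξ - ξ₀| ≤ c) → P ψ) (n : ℕ)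
    (hn : n * c ≤ b - a + c) (hab : a ≤ b) (ψ : 𝓢(ℝ, ℂ))
    (hψ : ∀ ξ, ψ ξ ≠ 0 → ξ ∈ Icc a (a + n * c)) :
    P ψ := by
  induction n generalizing ψ with
  | zero =>
    refine hP a ⟨le_rfl, hab⟩ ψ fun ξ hξ ↦ ?_
    have := hψ ξ hξ
    simp only [Nat.cast_zero, zero_mul, add_zero, Icc_self, mem_singleton_iff] at this
    simp [this, hc.le]
  | succ n ih =>
    push_cast at hn hψ
    have hψc : HasCompactSupport ψ :=
      HasCompactSupport.intro (isCompact_Icc (a := a) (b := a + (n + 1) * c)) fun ξ hξ ↦ by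
        by_contra h0
        exact hξ (hψ ξ h0)
    let σ : ℝ → ℂ := fun ξ ↦ (Real.smoothTransition ((ξ - a) / c - (n - 1)) : ℂ)
    have hσ : ContDiff ℝ ∞ σ :=
      Complex.ofRealCLM.contDiff.comp (Real.smoothTransition.contDiff.comp (by fun_prop))
    let ψ₁ : 𝓢(ℝ, ℂ) := (hψc.mul_left (f := σ)).toSchwartzMap (hσ.mul (ψ.smooth ⊤))
    let ψ₂ : 𝓢(ℝ, ℂ) := (hψc.mul_left (f := 1 - σ)).toSchwartzMap
      ((contDiff_const.sub hσ).mul (ψ.smooth ⊤))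
    have h1 : ∀ ξ, ψ₁ ξ = σ ξ * ψ ξ := fun ξ ↦ rfl
    have h2 : ∀ ξ, ψ₂ ξ = (1 - σ ξ) * ψ ξ := fun ξ ↦ rfl
    have h12 : ψ = ψ₁ + ψ₂ := by
      ext ξ
      rw [add_apply, h1, h2]
      ring
    rw [h12]
    refine hadd _ _ (hP (a + n * c) ⟨le_add_of_nonneg_right (by positivity), by linarith⟩ ψ₁
      fun ξ hξ ↦ ?_)
      (ih (by linarith) ψ₂ fun ξ hξ ↦ ?_)
    · rw [h1, mul_ne_zero_iff] at hξ
      have h3 := hψ ξ hξ.2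
      have h4 : 0 < (ξ - a) / c - (n - 1) := by
        by_contra! hle
        exact hξ.1 (by simp [σ, Real.smoothTransition.zero_of_nonpos hle])
      rw [sub_pos, lt_div_iff₀ hc] at h4
      rw [abs_le]
      constructor <;> linarith [h3.2]
    · rw [h2, mul_ne_zero_iff] at hξ
      have h3 := hψ ξ hξ.2
      have h4 : (ξ - a) / c - (n - 1) < 1 := by
        by_contra! hle
        exact hξ.1 (by simp [σ, Real.smoothTransition.one_of_one_le hle])
      have h5 : (ξ - a) / c < n := by linarith
      rw [div_lt_iff₀ hc] at h5
      exact ⟨h3.1, by linarith⟩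

lemma integral_fourierInv_mul_eq_zero_of_fourier_ne_zero {f h : ℝ → ℂ} (hf : Integrable f)
    (hF : ∀ ξ, 𝓕 f ξ ≠ 0) (hh : Continuous h) {M : ℝ} (hM : ∀ x, ‖h x‖ ≤ M)
    (hfh : ∀ t, ∫ s, f s * h (t - s) = 0) {R : ℝ} (hR : 0 ≤ R) {ψ : 𝓢(ℝ, ℂ)}
    (hψ : ∀ ξ, ψ ξ ≠ 0 → ξ ∈ Icc (-R) R) (x : ℝ) : ∫ s, (𝓕⁻ ψ) s * h (x - s) = 0 := by
  have hFc : Continuous (𝓕 f) :=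
    VectorFourier.fourierIntegral_continuous continuous_fourierChar (innerSL ℝ).continuous₂ hf
  obtain ⟨ξ₁, -, hξ₁⟩ := isCompact_Icc.exists_isMinOn (nonempty_Icc.2 (neg_le_self hR))
    hFc.norm.continuousOn
  obtain ⟨c, hc, hlt⟩ := exists_integral_norm_mul_modulus_lt hf (cutoffKernel 0 one_pos)
    (norm_pos_iff.2 (hF ξ₁))
  have hn := Nat.le_ceil (2 * R / c)
  have hn' := Nat.ceil_lt_add_one (a := 2 * R / c) (by positivity)
  rw [div_le_iff₀ hc] at hn
  rw [← sub_lt_iff_lt_add, lt_div_iff₀ hc] at hn'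
  refine SchwartzMap.induction_on_support (P := fun ψ ↦ ∫ s, (𝓕⁻ ψ) s * h (x - s) = 0)
    (a := -R) (b := R) ?_ hc ?_ ⌈2 * R / c⌉₊ (by linarith) (by linarith) ψ
    fun ξ hξ ↦ ⟨(hψ ξ hξ).1, by linarith [(hψ ξ hξ).2]⟩
  · intro ψ₁ ψ₂ h₁ h₂
    have hint : ∀ φ : 𝓢(ℝ, ℂ), Integrable fun s ↦ φ s * h (x - s) := fun φ ↦
      φ.integrable.mul_bdd (hh.comp (continuous_const.sub continuous_id)).aestronglyMeasurable
        (Eventually.of_forall fun s ↦ hM _)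
    simp only [FourierTransform.fourierInv_add, add_apply, add_mul]
    rw [integral_add (hint _) (hint _), h₁, h₂, add_zero]
  · intro ξ₀ hξ₀ ψ₀ hψ₀
    exact integral_fourierInv_mul_eq_zero_of_support_subset hf hh hM hfh hc
      (hlt.trans_le (hξ₁ hξ₀)) hψ₀ x

lemma integral_cutoffKernel : ∫ x, cutoffKernel 0 one_pos x = 1 := by
  have h : (𝓕 (cutoffKernel 0 one_pos) : 𝓢(ℝ, ℂ)) 0 = 1 := by
    rw [cutoffKernel, FourierTransform.fourier_fourierInv_eq]
    exact cutoffAt_eq_one one_pos (by simp)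
  rw [SchwartzMap.fourier_coe, Real.fourier_real_eq] at h
  simpa using h

lemma tendsto_integral_cutoffKernel_mul {h : ℝ → ℂ} (hh : Continuous h) {M : ℝ}
    (hM : ∀ x, ‖h x‖ ≤ M) (x : ℝ) :
    Tendsto (fun n : ℕ ↦ ∫ s, cutoffKernel 0 (Nat.cast_add_one_pos (α := ℝ) n) s * h (x - s)) atTop
      (𝓝 (h x)) := by
  set V : 𝓢(ℝ, ℂ) := cutoffKernel 0 one_pos with hV
  have hscale : ∀ n : ℕ, ∫ s, cutoffKernel 0 (Nat.cast_add_one_pos (α := ℝ) n) s * h (x - s) =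
      ∫ s, V s * h (x - s / ((n : ℝ) + 1)) := fun n ↦ by
    have hn := Nat.cast_add_one_pos (α := ℝ) n
    have h1 : ∀ s, cutoffKernel 0 hn s * h (x - s) = (((n : ℝ) + 1 : ℝ) : ℂ) *
        (V (((n : ℝ) + 1) * s) * h (x - (((n : ℝ) + 1) * s) / ((n : ℝ) + 1))) := fun s ↦ by
      rw [cutoffKernel_apply 0 hn, mul_div_cancel_left₀ _ hn.ne']
      simp [mul_assoc, hV]
    simp_rw [h1]
    rw [integral_const_mul, Measure.integral_comp_mul_left
      (fun s ↦ V s * h (x - s / ((n : ℝ) + 1))), abs_of_pos (inv_pos.2 hn), Complex.real_smul,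
      ← mul_assoc, ← Complex.ofReal_mul, mul_inv_cancel₀ hn.ne', Complex.ofReal_one, one_mul]
  simp_rw [hscale]
  have hlim : ∫ s, V s * h x = h x := by
    rw [integral_mul_const, integral_cutoffKernel, one_mul]
  have hVi : Integrable V := V.integrable
  rw [← hlim]
  refine tendsto_integral_of_dominated_convergence (fun s ↦ ‖V s‖ * M) (fun n ↦ ?_)
    (hVi.norm.mul_const M) (fun n ↦ Eventually.of_forall fun s ↦ ?_)
    (Eventually.of_forall fun s ↦ ?_)
  · exact (V.continuous.mul (hh.comp (by fun_prop))).aestronglyMeasurable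
  · rw [norm_mul]
    gcongr
    exact hM _
  · refine Tendsto.const_mul _ ((hh.tendsto x).comp ?_)
    have h0 := (tendsto_one_div_add_atTop_nhds_zero_nat (𝕜 := ℝ)).const_mul s
    simpa [div_eq_mul_inv] using h0.const_sub x

/-- **Wiener's Tauberian theorem**, for bounded continuous functions annihilated by an integrable
function with non-vanishing Fourier transform. -/
theorem eq_zero_of_fourier_ne_zero {f h : ℝ → ℂ} (hf : Integrable f)
    (hF : ∀ ξ, 𝓕 f ξ ≠ 0) (hh : Continuous h) {M : ℝ} (hM : ∀ x, ‖h x‖ ≤ M)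
    (hfh : ∀ t, ∫ s, f s * h (t - s) = 0) (x : ℝ) : h x = 0 := by
  refine tendsto_nhds_unique (tendsto_integral_cutoffKernel_mul hh hM x)
    (tendsto_const_nhds.congr fun n ↦ ?_)
  have hn := Nat.cast_add_one_pos (α := ℝ) n
  refine (integral_fourierInv_mul_eq_zero_of_fourier_ne_zero hf hF hh hM hfh
    (R := 2 * ((n : ℝ) + 1)) (by positivity) (fun ξ hξ ↦ ?_) x).symm
  by_contra hmem
  refine hξ ?_
  rw [cutoffAt_apply, Complex.ofReal_eq_zero, sub_zero]
  refine cutoff.zero_of_le_dist ?_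
  rw [dist_zero_right, Real.norm_eq_abs, abs_div, abs_of_pos hn, le_div_iff₀ hn]
  rw [mem_Icc, ← abs_le, not_le] at hmem
  exact hmem.le

lemma integrable_mul_mul_of_integrable {f φ g : ℝ → ℂ} (hf : Integrable f)
    (hφ : Continuous φ) {C : ℝ} (hC : ∀ x, ‖φ x‖ ≤ C) (hg : Integrable g) (hgm : Measurable g)
    (t : ℝ) : Integrable fun p : ℝ × ℝ ↦ f p.1 * (φ p.2 * g (t - p.1 - p.2)) := by
  have hmeas : AEStronglyMeasurable (fun p : ℝ × ℝ ↦ f p.1 * g (t - p.1 - p.2))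
      (volume.prod volume) :=
    hf.aestronglyMeasurable.comp_fst.mul
      (hgm.comp (g := g) (f := fun p : ℝ × ℝ ↦ t - p.1 - p.2)
        (by fun_prop)).aestronglyMeasurable
  have hint : Integrable (fun p : ℝ × ℝ ↦ f p.1 * g (t - p.1 - p.2)) (volume.prod volume) := by
    refine (integrable_prod_iff hmeas).2 ⟨Eventually.of_forall fun s ↦
      (hg.comp_sub_left (t - s)).const_mul (f s), ?_⟩
    have h1 : ∀ s, ∫ r, ‖f s * g (t - s - r)‖ = ‖f s‖ * ∫ r, ‖g r‖ := fun s ↦ by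
      simp_rw [norm_mul]
      rw [integral_const_mul, integral_sub_left_eq_self (fun r ↦ ‖g r‖) _ (t - s)]
    simp_rw [h1]
    exact hf.norm.mul_const _
  refine (hint.bdd_mul (c := C) (f := fun p : ℝ × ℝ ↦ φ p.2)
    (hφ.comp continuous_snd).aestronglyMeasurable
    (Eventually.of_forall fun p ↦ hC _)).congr (Eventually.of_forall fun p ↦ ?_)
  ring

/-- **Wiener's Tauberian theorem** for functions in `L¹ + L^∞`. -/
theorem ae_eq_zero_of_fourier_ne_zero {f g₁ g₂ : ℝ → ℂ} (hf : Integrable f)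
    (hF : ∀ ξ, 𝓕 f ξ ≠ 0) (hg₁ : Integrable g₁) (hg₁m : Measurable g₁) (hg₂m : Measurable g₂)
    {M : ℝ} (hM : ∀ x, ‖g₂ x‖ ≤ M) (hfg : ∀ t, ∫ s, f s * (g₁ (t - s) + g₂ (t - s)) = 0) :
    ∀ᵐ x, g₁ x + g₂ x = 0 := by
  have hg₂ : LocallyIntegrable g₂ :=
    (locallyIntegrable_const M).mono hg₂m.aestronglyMeasurable
      (Eventually.of_forall fun x ↦ (hM x).trans (le_abs_self M))
  have hg : LocallyIntegrable fun x ↦ g₁ x + g₂ x := hg₁.locallyIntegrable.add hg₂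
  refine ae_eq_zero_of_integral_contDiff_smul_eq_zero hg fun θ hθ hθs ↦ ?_
  let φ : ℝ → ℂ := fun s ↦ (θ (-s) : ℂ)
  have hφc : Continuous φ := Complex.continuous_ofReal.comp (hθ.continuous.comp continuous_neg)
  have hφs : HasCompactSupport φ :=
    (hθs.comp_homeomorph (Homeomorph.neg ℝ)).comp_left Complex.ofReal_zero
  have hφ : Integrable φ := hφc.integrable_of_hasCompactSupport hφs
  obtain ⟨C, hC⟩ := hφs.exists_bound_of_continuous hφc
  let h : ℝ → ℂ := fun x ↦ ∫ r, φ r * (g₁ (x - r) + g₂ (x - r))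
  have hhc : Continuous h :=
    hφs.continuous_convolution_left (ContinuousLinearMap.mul ℂ ℂ) hφc hg
  have hhM : ∀ x, ‖h x‖ ≤ C * (∫ r, ‖g₁ r‖) + (∫ r, ‖φ r‖) * M := fun x ↦ by
    have h1 := hg₁.norm.comp_sub_left x
    rw [← integral_sub_left_eq_self (fun r ↦ ‖g₁ r‖) _ x, ← integral_const_mul,
      ← integral_mul_const, ← integral_add (h1.const_mul C) (hφ.norm.mul_const M)]
    refine norm_integral_le_of_norm_le ((h1.const_mul C).add (hφ.norm.mul_const M))
      (Eventually.of_forall fun r ↦ ?_)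
    rw [mul_add]
    refine (norm_add_le _ _).trans ?_
    rw [norm_mul, norm_mul]
    gcongr
    exacts [hC r, hM _]
  have hfh : ∀ t, ∫ s, f s * h (t - s) = 0 := fun t ↦ by
    have hint : Integrable fun p : ℝ × ℝ ↦
        f p.1 * (φ p.2 * (g₁ (t - p.1 - p.2) + g₂ (t - p.1 - p.2))) := by
      simp_rw [mul_add]
      exact (integrable_mul_mul_of_integrable hf hφc hC hg₁ hg₁m t).add
        (integrable_mul_mul_of_bounded hf hφ hg₂m hM t)
    rw [integral_mul_integral_mul_comm (h := fun x ↦ g₁ x + g₂ x) hint]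
    simp [hfg]
  have h0 := eq_zero_of_fourier_ne_zero hf hF hhc hhM hfh 0
  simp only [h, φ, zero_sub] at h0
  rw [integral_neg_eq_self (fun r ↦ (θ r : ℂ) * (g₁ r + g₂ r))] at h0
  simpa only [Complex.real_smul] using h0

lemma integrable_indicator_of_lintegral_conjugate_lt_top (Ψ : ℝ → ℝ) {g : ℝ → ℝ}
    (hg : Measurable g)
    (hfin : ∫⁻ s, ⨆ (y : ℝ) (_ : 0 ≤ y), ENNReal.ofReal (|g s| * y - Ψ y) < ⊤) :
    Integrable ({s | 2 * Ψ 1 < |g s|}.indicator g) := by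
  have hmeas : MeasurableSet {s | 2 * Ψ 1 < |g s|} := measurableSet_lt measurable_const hg.abs
  refine ⟨(hg.indicator hmeas).aestronglyMeasurable, ?_⟩
  have hle : ∀ s, ‖{s | 2 * Ψ 1 < |g s|}.indicator g s‖ₑ ≤
      2 * ⨆ (y : ℝ) (_ : 0 ≤ y), ENNReal.ofReal (|g s| * y - Ψ y) := fun s ↦ by
    by_cases hs : s ∈ {s | 2 * Ψ 1 < |g s|}
    · rw [indicator_of_mem hs]
      calc ‖g s‖ₑ = ENNReal.ofReal |g s| := by rw [← ofReal_norm, Real.norm_eq_abs]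
        _ ≤ ENNReal.ofReal (2 * (|g s| * 1 - Ψ 1)) := by
          refine ENNReal.ofReal_le_ofReal ?_
          have : 2 * Ψ 1 < |g s| := hs
          linarith
        _ = 2 * ENNReal.ofReal (|g s| * 1 - Ψ 1) := by
          rw [ENNReal.ofReal_mul zero_le_two, ENNReal.ofReal_ofNat]
        _ ≤ _ := by
          gcongr
          exact le_iSup₂_of_le 1 zero_le_one le_rfl
    · rw [indicator_of_notMem hs]
      simp
  refine (lintegral_mono hle).trans_lt ?_
  rw [lintegral_const_mul' _ _ ENNReal.ofNat_ne_top]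
  exact ENNReal.mul_lt_top ENNReal.ofNat_lt_top hfin

/-- the annihilation step in the proof of Theorem 3.2.
If `f ∈ L¹(ℝ)` has non-vanishing Fourier transform and `g` belongs to the Orlicz
class of the complementary Young function `Ψ̄`, then `∫ f(t - s) g(s) ds = 0` for
all `t` forces `g = 0` almost everywhere. -/
theorem annihilator_of_nonvanishing_fourier
    (Ψ : ℝ → ℝ)
    (hΨ_nonneg : ∀ x, 0 ≤ Ψ x)
    (hΨ_even : ∀ x, Ψ (-x) = Ψ x)
    (hΨ_convex : ConvexOn ℝ Set.univ Ψ)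
    (hΨ_zero : ∀ x, Ψ x = 0 ↔ x = 0)
    (hΨ_Δ₂ : ∃ K > 0, ∀ x ≥ 0, Ψ (2 * x) ≤ K * Ψ x)
    (f : ℝ → ℝ) (hf_L1 : Integrable f)
    (hf_FT : ∀ ξ : ℝ,
      (∫ s : ℝ, Complex.exp (-2 * Real.pi * Complex.I * ξ * s) * (f s : ℂ)) ≠ 0)
    (g : ℝ → ℝ) (hg_meas : Measurable g)
    -- `∫ Ψ̄(|g|) < ∞`, where `Ψ̄(x) = sup_{y ≥ 0} (|x| y - Ψ y)` is the complementary
    -- Young function of `Ψ`: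
    (hg_Orlicz :
      ∫⁻ s, ⨆ (y : ℝ) (_ : 0 ≤ y), ENNReal.ofReal (|g s| * y - Ψ y) < ⊤)
    (h_ann : ∀ t : ℝ,
      Integrable (fun s => f (t - s) * g s) ∧ (∫ s, f (t - s) * g s) = 0) :
    g =ᵐ[volume] 0 := by
  set S : Set ℝ := {s | 2 * Ψ 1 < |g s|} with hS
  have hSm : MeasurableSet S := measurableSet_lt measurable_const hg_meas.abs
  have hsum : ∀ x, ((S.indicator g x : ℝ) : ℂ) + ((Sᶜ.indicator g x : ℝ) : ℂ) = g x := fun x ↦ by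
    rw [← Complex.ofReal_add, indicator_self_add_compl_apply]
  have hF : ∀ ξ, 𝓕 (fun s ↦ (f s : ℂ)) ξ ≠ 0 := fun ξ ↦ by
    refine ne_of_eq_of_ne ((Real.fourier_real_eq_integral_exp_smul _ ξ).trans
      (integral_congr_ae (Eventually.of_forall fun s ↦ ?_))) (hf_FT ξ)
    simp only [smul_eq_mul]
    congr 2
    push_cast
    ring
  have hzero := ae_eq_zero_of_fourier_ne_zero (f := fun s ↦ (f s : ℂ))
    (g₁ := fun x ↦ ((S.indicator g x : ℝ) : ℂ)) (g₂ := fun x ↦ ((Sᶜ.indicator g x : ℝ) : ℂ))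
    hf_L1.ofReal hF
    (integrable_indicator_of_lintegral_conjugate_lt_top Ψ hg_meas hg_Orlicz).ofReal
    (Complex.measurable_ofReal.comp (hg_meas.indicator hSm))
    (Complex.measurable_ofReal.comp (hg_meas.indicator hSm.compl)) (M := 2 * Ψ 1)
    (fun x ↦ ?_) (fun t ↦ ?_)
  · filter_upwards [hzero] with x hx
    rw [hsum] at hx
    exact_mod_cast hx
  · rw [Complex.norm_real]
    by_cases hx : x ∈ S
    · rw [indicator_of_notMem (by simpa using hx), norm_zero]
      exact mul_nonneg zero_le_two (hΨ_nonneg 1)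
    · rw [indicator_of_mem (by simpa using hx)]
      simpa [hS] using hx
  · simp_rw [hsum, ← Complex.ofReal_mul]
    rw [integral_complex_ofReal, Complex.ofReal_eq_zero,
      ← integral_sub_left_eq_self _ _ t]
    simpa using (h_ann t).2
end

section
/- Let Ψ : ℝ → [0,∞) be a finite-valued Young function satisfying the Δ₂-condition, let (S, 𝔅, μ) be a σ-finite measure space, and let Ψ̄(x) := sup_{y ≥ 0}(|x|y − Ψ(y)) be the complementary function of Ψ. Let (f_α)_{α ∈ Λ} be a family of measurable functions S → ℝ with ∫_S Ψ(|f_α|) dμ < ∞ for every α. Then the linear span of (f_α)_{α ∈ Λ} is dense in L_Ψ := {f measurable : ∫_S Ψ(|f|) dμ < ∞} with respect to the Luxemburg norm ‖f‖₀ := inf{a > 0 : ∫_S Ψ(|f|/a) dμ ≤ 1} if and only if the following holds: every measurable g : S → ℝ with ∫_S Ψ̄(|g|) dμ < ∞ satisfying ∫_S f_α g dμ = 0 for all α ∈ Λ is equal to 0 μ-almost everywhere. -/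
open MeasureTheory Set Filter
open scoped ENNReal Topology

/-- A finite-valued Young function satisfying the Δ₂-condition. -/
structure IsDeltaTwoYoung (Ψ : ℝ → ℝ) : Prop where
  nonneg : ∀ x, 0 ≤ Ψ x
  even : ∀ x, Ψ (-x) = Ψ x
  convex : ConvexOn ℝ Set.univ Ψ
  eq_zero_iff : ∀ x, Ψ x = 0 ↔ x = 0
  delta_two : ∃ K > 0, ∀ x ≥ 0, Ψ (2 * x) ≤ K * Ψ x

namespace IsDeltaTwoYoung

variable {Ψ : ℝ → ℝ}

lemma apply_zero (hΨ : IsDeltaTwoYoung Ψ) : Ψ 0 = 0 := (hΨ.eq_zero_iff 0).2 rfl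

lemma continuous (hΨ : IsDeltaTwoYoung Ψ) : Continuous Ψ :=
  continuousOn_univ.1 (hΨ.convex.continuousOn isOpen_univ)

lemma measurable (hΨ : IsDeltaTwoYoung Ψ) : Measurable Ψ := hΨ.continuous.measurable

lemma apply_mul_le (hΨ : IsDeltaTwoYoung Ψ) {t : ℝ} (h0 : 0 ≤ t) (h1 : t ≤ 1) (x : ℝ) :
    Ψ (t * x) ≤ t * Ψ x := by
  have := hΨ.convex.2 (mem_univ x) (mem_univ (0 : ℝ)) h0 (sub_nonneg.2 h1) (by ring)
  simpa [hΨ.apply_zero] using this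

lemma mono (hΨ : IsDeltaTwoYoung Ψ) {x y : ℝ} (hx : 0 ≤ x) (hxy : x ≤ y) : Ψ x ≤ Ψ y := by
  rcases hx.eq_or_lt with rfl | hx
  · rw [hΨ.apply_zero]; exact hΨ.nonneg y
  · have hy : 0 < y := hx.trans_le hxy
    have h1 : x / y ≤ 1 := (div_le_one hy).2 hxy
    have h := hΨ.apply_mul_le (by positivity) h1 y
    rw [div_mul_cancel₀ _ hy.ne'] at h
    exact h.trans (mul_le_of_le_one_left (hΨ.nonneg y) h1)

lemma exists_apply_mul_le (hΨ : IsDeltaTwoYoung Ψ) (c : ℝ) :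
    ∃ K : ℝ, 0 ≤ K ∧ ∀ x ≥ 0, Ψ (c * x) ≤ K * Ψ x := by
  obtain ⟨K, hK, h⟩ := hΨ.delta_two
  have hpow : ∀ n : ℕ, ∀ x ≥ 0, Ψ (2 ^ n * x) ≤ K ^ n * Ψ x := by
    intro n
    induction n with
    | zero => simp
    | succ n ih =>
      intro x hx
      calc Ψ (2 ^ (n + 1) * x) = Ψ (2 * (2 ^ n * x)) := by ring_nf
        _ ≤ K * Ψ (2 ^ n * x) := h _ (by positivity)
        _ ≤ K * (K ^ n * Ψ x) := by gcongr; exact ih x hx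
        _ = K ^ (n + 1) * Ψ x := by ring
  obtain ⟨n, hn⟩ := pow_unbounded_of_one_lt |c| (one_lt_two (α := ℝ))
  refine ⟨K ^ n, by positivity, fun x hx => ?_⟩
  have habs : Ψ (c * x) = Ψ |c * x| := by
    rcases abs_choice (c * x) with h | h <;> rw [h]
    rw [hΨ.even]
  rw [habs, abs_mul, abs_of_nonneg hx]
  exact (hΨ.mono (by positivity) (by gcongr)).trans (hpow n x hx)

lemma apply_abs_combo_le (hΨ : IsDeltaTwoYoung Ψ) {a b : ℝ} (ha : 0 ≤ a) (hb : 0 ≤ b)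
    (hab : a + b = 1) (x y : ℝ) : Ψ |a * x + b * y| ≤ a * Ψ |x| + b * Ψ |y| := by
  have h1 : |a * x + b * y| ≤ a * |x| + b * |y| := by
    simpa [abs_mul, abs_of_nonneg ha, abs_of_nonneg hb] using abs_add_le (a * x) (b * y)
  exact (hΨ.mono (abs_nonneg _) h1).trans
    (hΨ.convex.2 (mem_univ |x|) (mem_univ |y|) ha hb hab)

end IsDeltaTwoYoung

/-- The modular `∫ Ψ(|f|) dμ`. -/
noncomputable def orliczModular {S : Type*} [MeasurableSpace S] (μ : Measure S) (Ψ : ℝ → ℝ)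
    (f : S → ℝ) : ℝ≥0∞ :=
  ∫⁻ s, ENNReal.ofReal (Ψ |f s|) ∂μ

section Modular

variable {S : Type*} [MeasurableSpace S] {μ : Measure S} {Ψ : ℝ → ℝ}

lemma orliczModular_mono (hΨ : IsDeltaTwoYoung Ψ) {f g : S → ℝ} (h : ∀ s, |f s| ≤ |g s|) :
    orliczModular μ Ψ f ≤ orliczModular μ Ψ g :=
  lintegral_mono fun s => ENNReal.ofReal_le_ofReal (hΨ.mono (abs_nonneg _) (h s))

lemma measurable_ofReal_comp_abs (hΨ : IsDeltaTwoYoung Ψ) {f : S → ℝ} (hf : Measurable f) :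
    Measurable fun s => ENNReal.ofReal (Ψ |f s|) :=
  (hΨ.measurable.comp hf.abs).ennreal_ofReal

lemma orliczModular_combo_le (hΨ : IsDeltaTwoYoung Ψ) {f g : S → ℝ} (hf : Measurable f)
    {a b : ℝ} (ha : 0 ≤ a) (hb : 0 ≤ b) (hab : a + b = 1) :
    orliczModular μ Ψ (a • f + b • g) ≤
      ENNReal.ofReal a * orliczModular μ Ψ f + ENNReal.ofReal b * orliczModular μ Ψ g := by
  unfold orliczModular
  rw [← lintegral_const_mul' _ _ ENNReal.ofReal_ne_top,
    ← lintegral_const_mul' _ _ ENNReal.ofReal_ne_top,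
    ← lintegral_add_left ((measurable_ofReal_comp_abs hΨ hf).const_mul _)]
  refine lintegral_mono fun s => ?_
  rw [← ENNReal.ofReal_mul ha, ← ENNReal.ofReal_mul hb, ← ENNReal.ofReal_add
    (mul_nonneg ha (hΨ.nonneg _)) (mul_nonneg hb (hΨ.nonneg _))]
  exact ENNReal.ofReal_le_ofReal (hΨ.apply_abs_combo_le ha hb hab _ _)

lemma orliczModular_smul_lt_top (hΨ : IsDeltaTwoYoung Ψ) {f : S → ℝ}
    (hf : orliczModular μ Ψ f < ∞) (c : ℝ) : orliczModular μ Ψ (c • f) < ∞ := by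
  obtain ⟨K, hK, h⟩ := hΨ.exists_apply_mul_le |c|
  calc orliczModular μ Ψ (c • f)
      ≤ ∫⁻ s, ENNReal.ofReal K * ENNReal.ofReal (Ψ |f s|) ∂μ := by
        refine lintegral_mono fun s => ?_
        rw [← ENNReal.ofReal_mul hK]
        refine ENNReal.ofReal_le_ofReal ?_
        simpa [abs_mul] using h |f s| (abs_nonneg _)
    _ = ENNReal.ofReal K * orliczModular μ Ψ f := lintegral_const_mul' _ _ ENNReal.ofReal_ne_top
    _ < ∞ := ENNReal.mul_lt_top ENNReal.ofReal_lt_top hf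

lemma orliczModular_add_lt_top (hΨ : IsDeltaTwoYoung Ψ) {f g : S → ℝ} (hfm : Measurable f)
    (hf : orliczModular μ Ψ f < ∞) (hg : orliczModular μ Ψ g < ∞) :
    orliczModular μ Ψ (f + g) < ∞ := by
  have h : f + g = (1 / 2 : ℝ) • ((2 : ℝ) • f) + (1 / 2 : ℝ) • ((2 : ℝ) • g) := by
    simp [smul_smul]
  rw [h]
  refine (orliczModular_combo_le hΨ (hfm.const_smul _) (by norm_num) (by norm_num)
    (by norm_num)).trans_lt ?_
  exact ENNReal.add_lt_top.2
    ⟨ENNReal.mul_lt_top ENNReal.ofReal_lt_top (orliczModular_smul_lt_top hΨ hf _),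
      ENNReal.mul_lt_top ENNReal.ofReal_lt_top (orliczModular_smul_lt_top hΨ hg _)⟩

variable (μ) in
/-- The Orlicz space `L_Ψ`, as a space of functions. -/
def orliczSpace (hΨ : IsDeltaTwoYoung Ψ) : Submodule ℝ (S → ℝ) where
  carrier := {f | Measurable f ∧ orliczModular μ Ψ f < ∞}
  add_mem' := fun hf hg => ⟨hf.1.add hg.1, orliczModular_add_lt_top hΨ hf.1 hf.2 hg.2⟩
  zero_mem' := ⟨measurable_const, by simp [orliczModular, hΨ.apply_zero]⟩
  smul_mem' := fun c _ hf => ⟨hf.1.const_smul c, orliczModular_smul_lt_top hΨ hf.2 c⟩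

lemma mem_orliczSpace {hΨ : IsDeltaTwoYoung Ψ} {f : S → ℝ} :
    f ∈ orliczSpace μ hΨ ↔ Measurable f ∧ orliczModular μ Ψ f < ∞ := Iff.rfl

lemma mem_orliczSpace_of_abs_le {hΨ : IsDeltaTwoYoung Ψ} {f F : S → ℝ} (hf : Measurable f)
    (hF : F ∈ orliczSpace μ hΨ) (h : ∀ s, |f s| ≤ |F s|) : f ∈ orliczSpace μ hΨ :=
  ⟨hf, (orliczModular_mono hΨ h).trans_lt hF.2⟩

lemma mul_mem_orliczSpace {hΨ : IsDeltaTwoYoung Ψ} {u F : S → ℝ} (hu : Measurable u)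
    (hF : F ∈ orliczSpace μ hΨ) {C : ℝ} (h : ∀ s, |u s| ≤ C) :
    (fun s => u s * F s) ∈ orliczSpace μ hΨ := by
  refine mem_orliczSpace_of_abs_le (hu.mul hF.1) ((orliczSpace μ hΨ).smul_mem C hF) fun s => ?_
  simp only [Pi.smul_apply, smul_eq_mul, abs_mul]
  exact mul_le_mul_of_nonneg_right ((h s).trans (le_abs_self C)) (abs_nonneg _)

lemma orliczModular_inv_smul_le_one (hΨ : IsDeltaTwoYoung Ψ) {f : S → ℝ} (hfm : Measurable f)
    {r : ℝ} (hr : 1 ≤ r) (hf : orliczModular μ Ψ f ≤ ENNReal.ofReal r) :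
    orliczModular μ Ψ (r⁻¹ • f) ≤ 1 := by
  have hr0 : 0 < r := one_pos.trans_le hr
  have h := orliczModular_combo_le (μ := μ) (g := 0) hΨ hfm (a := r⁻¹) (b := 1 - r⁻¹)
    (by positivity) (sub_nonneg.2 (inv_le_one_of_one_le₀ hr)) (by ring)
  have h0 : orliczModular μ Ψ 0 = 0 := by simp [orliczModular, hΨ.apply_zero]
  rw [smul_zero, add_zero, h0, mul_zero, add_zero] at h
  calc _ ≤ _ := h
    _ ≤ ENNReal.ofReal r⁻¹ * ENNReal.ofReal r := by gcongr
    _ = 1 := by rw [← ENNReal.ofReal_mul (by positivity), inv_mul_cancel₀ hr0.ne',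
      ENNReal.ofReal_one]

variable (μ) in
lemma exists_pos_mem_orliczSpace [SigmaFinite μ] (hΨ : IsDeltaTwoYoung Ψ) :
    ∃ w ∈ orliczSpace μ hΨ, ∀ s, 0 < w s := by
  obtain ⟨g, hg0, hgm, hg⟩ := exists_pos_lintegral_lt_of_sigmaFinite μ one_ne_zero
  have hw : ∀ s, 0 < min (g s : ℝ) 1 := fun s => lt_min (hg0 s) one_pos
  refine ⟨fun s => min (g s : ℝ) 1, ⟨hgm.coe_nnreal_real.min measurable_const, ?_⟩, hw⟩
  calc orliczModular μ Ψ (fun s => min (g s : ℝ) 1)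
      ≤ ∫⁻ s, ENNReal.ofReal (Ψ 1) * g s ∂μ := by
        refine lintegral_mono fun s => ?_
        rw [← ENNReal.ofReal_coe_nnreal, ← ENNReal.ofReal_mul (hΨ.nonneg 1), abs_of_pos (hw s)]
        refine ENNReal.ofReal_le_ofReal ?_
        have := hΨ.apply_mul_le (hw s).le (min_le_right _ _) 1
        rw [mul_one, mul_comm] at this
        exact this.trans (mul_le_mul_of_nonneg_left (min_le_left _ _) (hΨ.nonneg 1))
    _ = ENNReal.ofReal (Ψ 1) * ∫⁻ s, g s ∂μ := lintegral_const_mul' _ _ ENNReal.ofReal_ne_top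
    _ < ∞ := ENNReal.mul_lt_top ENNReal.ofReal_lt_top (hg.trans ENNReal.one_lt_top)

/-- The unit ball of the modular. -/
def orliczBall (μ : Measure S) (hΨ : IsDeltaTwoYoung Ψ) : Set (orliczSpace μ hΨ) :=
  {f | orliczModular μ Ψ f ≤ 1}

lemma balanced_orliczBall (hΨ : IsDeltaTwoYoung Ψ) : Balanced ℝ (orliczBall μ hΨ) := by
  rintro a ha _ ⟨f, hf, rfl⟩
  refine (orliczModular_mono hΨ fun s => ?_).trans hf
  simpa [abs_mul] using mul_le_of_le_one_left (abs_nonneg _) ha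

lemma convex_orliczBall (hΨ : IsDeltaTwoYoung Ψ) : Convex ℝ (orliczBall μ hΨ) := by
  intro f hf g hg a b ha hb hab
  calc orliczModular μ Ψ (a • f + b • g : S → ℝ)
      ≤ ENNReal.ofReal a * 1 + ENNReal.ofReal b * 1 :=
        (orliczModular_combo_le hΨ f.2.1 ha hb hab).trans (by gcongr; exacts [hf, hg])
    _ = 1 := by rw [mul_one, mul_one, ← ENNReal.ofReal_add ha hb, hab, ENNReal.ofReal_one]

lemma inv_smul_mem_orliczBall {hΨ : IsDeltaTwoYoung Ψ} (f : orliczSpace μ hΨ) {c : ℝ}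
    (hc : 1 + (orliczModular μ Ψ f).toReal ≤ |c|) : c⁻¹ • f ∈ orliczBall μ hΨ := by
  have h0 : 0 ≤ (orliczModular μ Ψ f).toReal := ENNReal.toReal_nonneg
  refine le_trans (orliczModular_mono hΨ (g := |c|⁻¹ • (f : S → ℝ)) fun s => ?_)
    (orliczModular_inv_smul_le_one hΨ f.2.1 (r := |c|) (by linarith) ?_)
  · simp [abs_mul]
  · rw [← ENNReal.ofReal_toReal f.2.2.ne]
    exact ENNReal.ofReal_le_ofReal (by linarith)

lemma absorbent_orliczBall (hΨ : IsDeltaTwoYoung Ψ) : Absorbent ℝ (orliczBall μ hΨ) := by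
  intro f
  have h0 : 0 ≤ (orliczModular μ Ψ f).toReal := ENNReal.toReal_nonneg
  refine Absorbs.of_norm ⟨1 + (orliczModular μ Ψ f).toReal, fun c hc => ?_⟩
  have hc0 : c ≠ 0 := by
    rintro rfl
    rw [norm_zero] at hc
    linarith
  rw [singleton_subset_iff, mem_smul_set_iff_inv_smul_mem₀ hc0]
  exact inv_smul_mem_orliczBall f hc

/-- The Luxemburg seminorm on `L_Ψ`. -/
noncomputable def luxemburg (μ : Measure S) (hΨ : IsDeltaTwoYoung Ψ) :
    Seminorm ℝ (orliczSpace μ hΨ) :=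
  gaugeSeminorm (balanced_orliczBall hΨ) (convex_orliczBall hΨ) (absorbent_orliczBall hΨ)

lemma luxemburg_apply {hΨ : IsDeltaTwoYoung Ψ} (f : orliczSpace μ hΨ) :
    luxemburg μ hΨ f =
      sInf {a : ℝ | 0 < a ∧ ∫⁻ s, ENNReal.ofReal (Ψ (|(f : S → ℝ) s| / a)) ∂μ ≤ 1} := by
  rw [luxemburg, gaugeSeminorm_toFun, gauge_def']
  congr 1
  ext a
  refine and_congr_right fun ha => ?_
  have ha : 0 < a := ha
  simp [orliczBall, orliczModular, abs_mul, abs_of_pos ha, div_eq_inv_mul]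

lemma luxemburg_le {hΨ : IsDeltaTwoYoung Ψ} (f : orliczSpace μ hΨ) :
    luxemburg μ hΨ f ≤ 1 + (orliczModular μ Ψ f).toReal := by
  have h0 : 0 ≤ (orliczModular μ Ψ f).toReal := ENNReal.toReal_nonneg
  have h1 : 0 < 1 + (orliczModular μ Ψ f).toReal := by linarith
  rw [luxemburg, gaugeSeminorm_toFun]
  refine gauge_le_of_mem h1.le ?_
  rw [mem_smul_set_iff_inv_smul_mem₀ h1.ne']
  exact inv_smul_mem_orliczBall f (le_abs_self _)

lemma exists_lt_of_luxemburg_lt {hΨ : IsDeltaTwoYoung Ψ} (f : orliczSpace μ hΨ) {ε : ℝ}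
    (h : luxemburg μ hΨ f < ε) :
    ∃ a : ℝ, 0 < a ∧ a < ε ∧ orliczModular μ Ψ (a⁻¹ • (f : S → ℝ)) ≤ 1 := by
  have hne : {a : ℝ | 0 < a ∧
      ∫⁻ s, ENNReal.ofReal (Ψ (|(f : S → ℝ) s| / a)) ∂μ ≤ 1}.Nonempty := by
    have h0 : 0 ≤ (orliczModular μ Ψ f).toReal := ENNReal.toReal_nonneg
    obtain ⟨r, hr⟩ : ∃ r : ℝ, r = 1 + (orliczModular μ Ψ f).toReal := ⟨_, rfl⟩
    have h1 : 0 < r := by linarith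
    refine ⟨r, h1, ?_⟩
    have := inv_smul_mem_orliczBall f (hr.symm.le.trans (le_abs_self r))
    simpa [orliczBall, orliczModular, abs_mul, abs_of_pos h1, div_eq_inv_mul] using this
  rw [luxemburg_apply] at h
  obtain ⟨a, ⟨ha, hf⟩, haε⟩ := exists_lt_of_csInf_lt hne h
  refine ⟨a, ha, haε, ?_⟩
  simpa [orliczModular, abs_mul, abs_of_pos ha, div_eq_inv_mul] using hf

end Modular

/-- A vector at positive distance from a subspace, with respect to a seminorm, is separated from
that subspace by a linear functional bounded by the seminorm. -/
lemma Seminorm.exists_functional_of_le {V : Type*} [AddCommGroup V] [Module ℝ V]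
    (p : Seminorm ℝ V) (M : Submodule ℝ V) (x : V) {ε : ℝ} (hε : 0 < ε)
    (h : ∀ m ∈ M, ε ≤ p (x - m)) :
    ∃ φ : V →ₗ[ℝ] ℝ, (∀ v, |φ v| ≤ p v) ∧ (∀ m ∈ M, φ m = 0) ∧ φ x ≠ 0 := by
  let _ : SeminormedAddCommGroup V := p.toAddGroupSeminorm.toSeminormedAddCommGroup
  have hnorm : ∀ v : V, ‖v‖ = p v := fun _ => rfl
  let _ : NormedSpace ℝ V := ⟨fun a v => by rw [hnorm, hnorm, map_smul_eq_mul]⟩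
  have hx : x ∉ closure (M : Set V) := by
    intro hx
    obtain ⟨m, hm, hd⟩ := Metric.mem_closure_iff.1 hx ε hε
    rw [dist_eq_norm, hnorm] at hd
    exact (h m hm).not_gt hd
  obtain ⟨f, u, hfx, hf⟩ :=
    geometric_hahn_banach_point_closed M.convex.closure isClosed_closure hx
  have hf' : ∀ m ∈ M, u < f m := fun m hm => hf m (subset_closure hm)
  have hu : u < 0 := by simpa using hf' 0 M.zero_mem
  have hM : ∀ m ∈ M, f m = 0 := by
    intro m hm
    by_contra hne
    have := hf' ((u / f m) • m) (M.smul_mem _ hm)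
    rw [map_smul, smul_eq_mul, div_mul_cancel₀ _ hne] at this
    exact this.false
  have hc : 0 < ‖f‖ + 1 := by positivity
  refine ⟨(‖f‖ + 1)⁻¹ • f.toLinearMap, fun v => ?_, fun m hm => ?_, ?_⟩
  · have h1 : |f v| ≤ ‖f‖ * p v := f.le_opNorm v
    have h2 : 0 ≤ p v := apply_nonneg p v
    simp only [LinearMap.smul_apply, ContinuousLinearMap.coe_coe, smul_eq_mul, abs_mul,
      abs_of_pos (inv_pos.2 hc)]
    rw [inv_mul_le_iff₀ hc]
    linarith
  · simp [hM m hm]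
  · have : f x ≠ 0 := (hfx.trans hu).ne
    simp only [LinearMap.smul_apply, ContinuousLinearMap.coe_coe, smul_eq_mul]
    exact mul_ne_zero (inv_pos.2 hc).ne' this

/-- The complementary function, with values in `ℝ≥0∞`. -/
noncomputable def youngConj (Ψ : ℝ → ℝ) (x : ℝ) : ℝ≥0∞ :=
  ⨆ (y : ℝ) (_ : 0 ≤ y), ENNReal.ofReal (|x| * y - Ψ y)

lemma ofReal_abs_mul_le_add_youngConj (Ψ : ℝ → ℝ) (x y : ℝ) :
    ENNReal.ofReal |x * y| ≤ ENNReal.ofReal (Ψ |x|) + youngConj Ψ y := by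
  have h : ENNReal.ofReal (|y| * |x| - Ψ |x|) ≤ youngConj Ψ y :=
    le_iSup₂_of_le |x| (abs_nonneg x) le_rfl
  calc ENNReal.ofReal |x * y| = ENNReal.ofReal (Ψ |x| + (|y| * |x| - Ψ |x|)) := by
        rw [abs_mul]; ring_nf
    _ ≤ _ := ENNReal.ofReal_add_le
    _ ≤ _ := by gcongr

section Duality

variable {S : Type*} [MeasurableSpace S] {μ : Measure S} {Ψ : ℝ → ℝ} {hΨ : IsDeltaTwoYoung Ψ}

lemma lintegral_abs_mul_le (hΨ : IsDeltaTwoYoung Ψ) {f : S → ℝ} (hf : Measurable f) (g : S → ℝ) :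
    ∫⁻ s, ENNReal.ofReal |f s * g s| ∂μ ≤
      orliczModular μ Ψ f + ∫⁻ s, youngConj Ψ (g s) ∂μ := by
  rw [orliczModular, ← lintegral_add_left (measurable_ofReal_comp_abs hΨ hf)]
  exact lintegral_mono fun s => ofReal_abs_mul_le_add_youngConj Ψ _ _

lemma integrable_mul_of_lintegral_abs_lt_top {f g : S → ℝ} (hf : Measurable f) (hg : Measurable g)
    (h : ∫⁻ s, ENNReal.ofReal |f s * g s| ∂μ < ∞) : Integrable (fun s => f s * g s) μ := by
  refine ⟨(hf.mul hg).aestronglyMeasurable, ?_⟩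
  rw [hasFiniteIntegral_iff_norm]
  exact h

lemma integrable_mul_of_youngConj {f g : S → ℝ} (hf : f ∈ orliczSpace μ hΨ) (hg : Measurable g)
    (hg' : ∫⁻ s, youngConj Ψ (g s) ∂μ < ∞) : Integrable (fun s => f s * g s) μ :=
  integrable_mul_of_lintegral_abs_lt_top hf.1 hg
    ((lintegral_abs_mul_le hΨ hf.1 g).trans_lt (ENNReal.add_lt_top.2 ⟨hf.2, hg'⟩))

/-- Continuity of the pairing with an element of the complementary class. -/
lemma abs_integral_mul_le {f g : S → ℝ} (hf : f ∈ orliczSpace μ hΨ) (hg : Measurable g)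
    (hg' : ∫⁻ s, youngConj Ψ (g s) ∂μ < ∞) {a : ℝ} (ha : 0 < a)
    (hfa : orliczModular μ Ψ (a⁻¹ • f) ≤ 1) :
    |∫ s, f s * g s ∂μ| ≤ a * (1 + (∫⁻ s, youngConj Ψ (g s) ∂μ).toReal) := by
  have hfa' := (orliczSpace μ hΨ).smul_mem a⁻¹ hf
  have hfint := integrable_mul_of_youngConj hfa' hg hg'
  have h1 : ∫ s, |(a⁻¹ • f) s * g s| ∂μ ≤ 1 + (∫⁻ s, youngConj Ψ (g s) ∂μ).toReal := by
    rw [← ENNReal.ofReal_le_ofReal_iff (by positivity),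
      ofReal_integral_eq_lintegral_ofReal hfint.abs (ae_of_all _ fun s => abs_nonneg _),
      ENNReal.ofReal_add zero_le_one ENNReal.toReal_nonneg, ENNReal.ofReal_toReal hg'.ne,
      ENNReal.ofReal_one]
    exact (lintegral_abs_mul_le hΨ hfa'.1 g).trans (by gcongr)
  have h2 : ∫ s, f s * g s ∂μ = a * ∫ s, (a⁻¹ • f) s * g s ∂μ := by
    rw [← integral_const_mul]
    refine integral_congr_ae (ae_of_all _ fun s => ?_)
    simp only [Pi.smul_apply, smul_eq_mul]
    field_simp
  rw [h2, abs_mul, abs_of_pos ha]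
  gcongr
  exact abs_integral_le_integral_abs.trans h1

/-- A functional controlled by the modular is continuous along dominated pointwise limits. -/
lemma tendsto_functional_of_dominated (φ : orliczSpace μ hΨ →ₗ[ℝ] ℝ)
    (hφ : ∀ h, |φ h| ≤ 1 + (orliczModular μ Ψ h).toReal)
    {ι : Type*} {l : Filter ι} [l.IsCountablyGenerated] (F : ι → orliczSpace μ hΨ)
    (f G : orliczSpace μ hΨ) (hFG : ∀ i s, |(F i : S → ℝ) s - (f : S → ℝ) s| ≤ |(G : S → ℝ) s|)
    (hF : ∀ s, Tendsto (fun i => (F i : S → ℝ) s) l (𝓝 ((f : S → ℝ) s))) :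
    Tendsto (fun i => φ (F i)) l (𝓝 (φ f)) := by
  have key : ∀ k : ℝ, 0 < k → ∀ᶠ i in l, |φ (F i) - φ f| ≤ 2 / k := by
    intro k hk
    have hlim : Tendsto (fun i => orliczModular μ Ψ (k • (F i - f) : orliczSpace μ hΨ)) l (𝓝 0) := by
      have h0 : ∫⁻ _ : S, (0 : ℝ≥0∞) ∂μ = 0 := lintegral_zero
      rw [← h0]
      refine tendsto_lintegral_filter_of_dominated_convergence
        (fun s => ENNReal.ofReal (Ψ |(k • G : orliczSpace μ hΨ).1 s|)) ?_ ?_ ?_ ?_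
      · exact Eventually.of_forall fun i => measurable_ofReal_comp_abs hΨ (k • (F i - f)).2.1
      · refine Eventually.of_forall fun i => ae_of_all _ fun s => ?_
        refine ENNReal.ofReal_le_ofReal (hΨ.mono (abs_nonneg _) ?_)
        simpa [abs_mul] using mul_le_mul_of_nonneg_left (hFG i s) (abs_nonneg k)
      · exact (k • G).2.2.ne
      · refine ae_of_all _ fun s => ?_
        have h1 : Tendsto (fun i => k * ((F i : S → ℝ) s - (f : S → ℝ) s)) l (𝓝 0) := by
          simpa using ((hF s).sub_const ((f : S → ℝ) s)).const_mul k
        have h2 : Tendsto (fun x => ENNReal.ofReal (Ψ |x|)) (𝓝 0) (𝓝 0) := by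
          have : Continuous fun x => ENNReal.ofReal (Ψ |x|) :=
            ENNReal.continuous_ofReal.comp (hΨ.continuous.comp continuous_abs)
          simpa [hΨ.apply_zero] using this.tendsto 0
        exact h2.comp h1
    filter_upwards [hlim.eventually_le_const one_pos] with i hi
    have h1 := hφ (k • (F i - f))
    have h2 : (orliczModular μ Ψ (k • (F i - f) : orliczSpace μ hΨ)).toReal ≤ 1 := by
      simpa using ENNReal.toReal_mono ENNReal.one_ne_top hi
    rw [map_smul, map_sub, smul_eq_mul, abs_mul, abs_of_pos hk] at h1
    rw [le_div_iff₀ hk]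
    linarith
  rw [Metric.tendsto_nhds]
  intro ε hε
  filter_upwards [key (4 / ε) (by positivity)] with i hi
  rw [Real.dist_eq]
  refine hi.trans_lt ?_
  have : 2 / (4 / ε) = ε / 2 := by field_simp; norm_num
  linarith

lemma indicator_mem_orliczSpace {A : Set S} (hA : MeasurableSet A) {w : S → ℝ}
    (hw : w ∈ orliczSpace μ hΨ) : A.indicator w ∈ orliczSpace μ hΨ :=
  mem_orliczSpace_of_abs_le (hw.1.indicator hA) hw fun s => norm_indicator_le_norm_self w s

open Classical in
/-- The signed measure `A ↦ φ (1_A w)` attached to a functional on `L_Ψ`. -/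
noncomputable def functionalMeasure (φ : orliczSpace μ hΨ →ₗ[ℝ] ℝ)
    (hφ : ∀ h, |φ h| ≤ 1 + (orliczModular μ Ψ h).toReal)
    (w : S → ℝ) (hw : w ∈ orliczSpace μ hΨ) : SignedMeasure S where
  measureOf' A := if hA : MeasurableSet A then φ ⟨A.indicator w, indicator_mem_orliczSpace hA hw⟩
    else 0
  empty' := by
    rw [dif_pos MeasurableSet.empty, ← map_zero φ]
    congr 1
    ext s
    simp
  not_measurable' A hA := dif_neg hA
  m_iUnion' A hA hd := by
    have hU := MeasurableSet.iUnion hA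
    simp only [dif_pos hU, dif_pos (hA _)]
    have hfin : ∀ t : Finset ℕ, MeasurableSet (⋃ i ∈ t, A i) := fun t =>
      t.measurableSet_biUnion fun i _ => hA i
    have hsum : ∀ t : Finset ℕ,
        ∑ i ∈ t, φ ⟨(A i).indicator w, indicator_mem_orliczSpace (hA i) hw⟩ =
          φ ⟨(⋃ i ∈ t, A i).indicator w, indicator_mem_orliczSpace (hfin t) hw⟩ := by
      intro t
      rw [← map_sum]
      congr 1
      ext s
      have := congrFun (Finset.indicator_biUnion t A (f := w) fun i _ j _ hij => hd hij) s
      simpa using this.symm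
    rw [HasSum, SummationFilter.unconditional_filter]
    simp_rw [hsum]
    refine tendsto_functional_of_dominated φ hφ _ _ ⟨w, hw⟩ (fun t s => ?_) fun s => ?_
    · have hsub : (⋃ i ∈ t, A i) ⊆ ⋃ i, A i := iUnion₂_subset_iUnion _ _
      change |(⋃ i ∈ t, A i).indicator w s - (⋃ i, A i).indicator w s| ≤ |w s|
      by_cases h1 : s ∈ ⋃ i ∈ t, A i
      · simp only [indicator_of_mem h1, indicator_of_mem (hsub h1), sub_self, abs_zero, abs_nonneg]
      · rw [indicator_of_notMem h1, zero_sub, abs_neg]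
        exact norm_indicator_le_norm_self w s
    · exact (tendsto_indicator_biUnion_finset A w s).mono_right (pure_le_nhds _)

lemma functionalMeasure_apply (φ : orliczSpace μ hΨ →ₗ[ℝ] ℝ)
    (hφ : ∀ h, |φ h| ≤ 1 + (orliczModular μ Ψ h).toReal)
    (w : S → ℝ) (hw : w ∈ orliczSpace μ hΨ) {A : Set S} (hA : MeasurableSet A) :
    functionalMeasure φ hφ w hw A = φ ⟨A.indicator w, indicator_mem_orliczSpace hA hw⟩ :=
  dif_pos hA

/-- A functional controlled by the modular vanishes on functions that are zero a.e. -/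
lemma functional_eq_zero_of_ae (φ : orliczSpace μ hΨ →ₗ[ℝ] ℝ)
    (hφ : ∀ h, |φ h| ≤ 1 + (orliczModular μ Ψ h).toReal)
    (f : orliczSpace μ hΨ) (hf : (f : S → ℝ) =ᵐ[μ] 0) : φ f = 0 := by
  by_contra hne
  have h1 := hφ ((2 / φ f) • f)
  have h2 : orliczModular μ Ψ ((2 / φ f) • f : orliczSpace μ hΨ) = 0 := by
    unfold orliczModular
    rw [lintegral_congr_ae (g := fun _ => 0), lintegral_zero]
    filter_upwards [hf] with s hs
    simp [hs, hΨ.apply_zero]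
  rw [h2, map_smul, smul_eq_mul, div_mul_cancel₀ _ hne] at h1
  norm_num at h1

lemma exists_density [SigmaFinite μ] (φ : orliczSpace μ hΨ →ₗ[ℝ] ℝ)
    (hφ : ∀ h, |φ h| ≤ 1 + (orliczModular μ Ψ h).toReal)
    (w : S → ℝ) (hw : w ∈ orliczSpace μ hΨ) :
    ∃ ρ : S → ℝ, Measurable ρ ∧ Integrable ρ μ ∧
      ∀ (u : SimpleFunc S ℝ) (hu : (fun s => u s * w s) ∈ orliczSpace μ hΨ),
        φ ⟨_, hu⟩ = ∫ s, u s * ρ s ∂μ := by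
  set ν := functionalMeasure φ hφ w hw with hν
  have hac : ν ≪ᵥ μ.toENNRealVectorMeasure := by
    refine VectorMeasure.AbsolutelyContinuous.mk fun A hA h0 => ?_
    rw [Measure.toENNRealVectorMeasure_apply_measurable hA] at h0
    rw [hν, functionalMeasure_apply φ hφ w hw hA]
    exact functional_eq_zero_of_ae φ hφ _ (indicator_meas_zero h0)
  have hfint := SignedMeasure.integrable_rnDeriv ν μ
  refine ⟨ν.rnDeriv μ, SignedMeasure.measurable_rnDeriv ν μ, hfint, fun u => ?_⟩
  have hmem : ∀ u : SimpleFunc S ℝ, (fun s => u s * w s) ∈ orliczSpace μ hΨ := fun u => by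
    obtain ⟨C, hC⟩ := u.exists_forall_norm_le
    exact mul_mem_orliczSpace u.measurable hw hC
  have hmulint : ∀ u : SimpleFunc S ℝ, Integrable (fun s => u s * ν.rnDeriv μ s) μ := fun u => by
    obtain ⟨C, hC⟩ := u.exists_forall_norm_le
    exact hfint.bdd_mul u.measurable.aestronglyMeasurable (ae_of_all _ hC)
  induction u using SimpleFunc.induction with
  | const c hA =>
    rename_i A
    intro hu
    have h1 : (⟨_, hu⟩ : orliczSpace μ hΨ) = c • ⟨A.indicator w, indicator_mem_orliczSpace hA hw⟩ := by
      ext s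
      by_cases hs : s ∈ A <;> simp [hs]
    have h2 : ∫ s in A, ν.rnDeriv μ s ∂μ = ν A := by
      rw [← withDensityᵥ_apply hfint hA, SignedMeasure.withDensityᵥ_rnDeriv_eq ν μ hac]
    rw [h1, map_smul, ← functionalMeasure_apply φ hφ w hw hA, ← hν, ← h2, smul_eq_mul,
      ← integral_const_mul, ← integral_indicator hA]
    refine integral_congr_ae (ae_of_all _ fun s => ?_)
    by_cases hs : s ∈ A <;> simp [hs]
  | add _ ihu ihv =>
    rename_i u v _
    intro huv
    have h1 : (⟨_, huv⟩ : orliczSpace μ hΨ) = ⟨_, hmem u⟩ + ⟨_, hmem v⟩ := by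
      ext s
      simp [add_mul]
    rw [h1, map_add, ihu, ihv, ← integral_add (hmulint u) (hmulint v)]
    refine integral_congr_ae (ae_of_all _ fun s => ?_)
    simp [add_mul]

/-- Integral representation of a functional controlled by the modular. -/
lemma exists_integral_representation [SigmaFinite μ] (φ : orliczSpace μ hΨ →ₗ[ℝ] ℝ)
    (hφ : ∀ h, |φ h| ≤ 1 + (orliczModular μ Ψ h).toReal) :
    ∃ g : S → ℝ, Measurable g ∧ ∀ f : orliczSpace μ hΨ,
      Integrable (fun s => (f : S → ℝ) s * g s) μ ∧ φ f = ∫ s, (f : S → ℝ) s * g s ∂μ := by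
  obtain ⟨w, hw, hw0⟩ := exists_pos_mem_orliczSpace μ hΨ
  obtain ⟨ρ, hρm, hρ, hφρ⟩ := exists_density φ hφ w hw
  have hg : Measurable fun s => ρ s / w s := hρm.div hw.1
  refine ⟨fun s => ρ s / w s, hg, fun f => ?_⟩
  have hum : Measurable fun s => (f : S → ℝ) s / w s := f.2.1.div hw.1
  let u : ℕ → SimpleFunc S ℝ := SimpleFunc.approxOn _ hum univ 0 trivial
  have hu : ∀ s, Tendsto (fun n => u n s) atTop (𝓝 ((f : S → ℝ) s / w s)) := fun s =>
    SimpleFunc.tendsto_approxOn hum (mem_univ 0) (by simp)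
  have hub : ∀ n s, |u n s * w s| ≤ |2 * (f : S → ℝ) s| := by
    intro n s
    have h := SimpleFunc.norm_approxOn_zero_le hum (s := univ) trivial s n
    rw [Real.norm_eq_abs, Real.norm_eq_abs, abs_div, abs_of_pos (hw0 s), ← two_mul] at h
    rw [abs_mul, abs_mul, abs_two, abs_of_pos (hw0 s)]
    calc |u n s| * w s ≤ 2 * (|(f : S → ℝ) s| / w s) * w s :=
          mul_le_mul_of_nonneg_right h (hw0 s).le
      _ = 2 * |(f : S → ℝ) s| := by rw [mul_assoc, div_mul_cancel₀ _ (hw0 s).ne']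
  have h2f : (fun s => 2 * (f : S → ℝ) s) ∈ orliczSpace μ hΨ := (orliczSpace μ hΨ).smul_mem 2 f.2
  have hmem : ∀ n, (fun s => u n s * w s) ∈ orliczSpace μ hΨ := fun n =>
    mem_orliczSpace_of_abs_le ((u n).measurable.mul hw.1) h2f (hub n)
  have hprod : ∀ s, (f : S → ℝ) s * (ρ s / w s) = (f : S → ℝ) s / w s * ρ s := fun s => by ring
  have hρint : ∀ v : SimpleFunc S ℝ, Integrable (fun s => v s * ρ s) μ := fun v => by
    obtain ⟨C, hC⟩ := v.exists_forall_norm_le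
    exact hρ.bdd_mul v.measurable.aestronglyMeasurable (ae_of_all _ hC)
  have hbound : ∀ n, ∫⁻ s, ENNReal.ofReal |u n s * ρ s| ∂μ ≤
      ENNReal.ofReal (1 + (orliczModular μ Ψ fun s => 2 * (f : S → ℝ) s).toReal) := by
    intro n
    have hpos : MeasurableSet {s | 0 ≤ ρ s} := measurableSet_le measurable_const hρm
    let v : SimpleFunc S ℝ := (u n).map (fun x => |x|) *
      SimpleFunc.piecewise {s | 0 ≤ ρ s} hpos (SimpleFunc.const S 1) (SimpleFunc.const S (-1))
    have hv : ∀ s, v s * ρ s = |u n s * ρ s| := by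
      intro s
      by_cases hs : 0 ≤ ρ s
      · simp [v, hs, abs_mul, abs_of_nonneg hs]
      · simp [v, hs, abs_mul, abs_of_neg (not_le.1 hs)]
    have hvabs : ∀ s, |v s * w s| = |u n s * w s| := by
      intro s
      by_cases hs : 0 ≤ ρ s <;> simp [v, hs, abs_mul]
    have hvb : ∀ s, |v s * w s| ≤ |2 * (f : S → ℝ) s| := fun s => (hvabs s).trans_le (hub n s)
    have hvmem : (fun s => v s * w s) ∈ orliczSpace μ hΨ :=
      mem_orliczSpace_of_abs_le (v.measurable.mul hw.1) h2f hvb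
    have h1 := hφρ v hvmem
    simp_rw [hv] at h1
    rw [← ofReal_integral_eq_lintegral_ofReal (hρint (u n)).abs (ae_of_all _ fun s => abs_nonneg _),
      ← h1]
    refine ENNReal.ofReal_le_ofReal ((le_abs_self _).trans ((hφ _).trans ?_))
    gcongr
    · exact h2f.2.ne
    · exact orliczModular_mono hΨ hvb
  have hfint : Integrable (fun s => (f : S → ℝ) s * (ρ s / w s)) μ := by
    refine integrable_mul_of_lintegral_abs_lt_top f.2.1 hg ?_
    calc ∫⁻ s, ENNReal.ofReal |(f : S → ℝ) s * (ρ s / w s)| ∂μ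
        = ∫⁻ s, liminf (fun n => ENNReal.ofReal |u n s * ρ s|) atTop ∂μ := by
          refine lintegral_congr fun s => ?_
          rw [hprod]
          exact (((ENNReal.continuous_ofReal.comp continuous_abs).tendsto _).comp
            ((hu s).mul_const (ρ s))).liminf_eq.symm
      _ ≤ liminf (fun n => ∫⁻ s, ENNReal.ofReal |u n s * ρ s| ∂μ) atTop :=
          lintegral_liminf_le fun n => ((u n).measurable.mul hρm).abs.ennreal_ofReal
      _ ≤ ENNReal.ofReal (1 + (orliczModular μ Ψ fun s => 2 * (f : S → ℝ) s).toReal) :=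
          liminf_le_of_le (by isBoundedDefault) fun b hb =>
            let ⟨n, hn⟩ := hb.exists
            hn.trans (hbound n)
      _ < ∞ := ENNReal.ofReal_lt_top
  refine ⟨hfint, ?_⟩
  have hlim1 : Tendsto (fun n => φ ⟨_, hmem n⟩) atTop (𝓝 (φ f)) := by
    refine tendsto_functional_of_dominated φ hφ (fun n => ⟨_, hmem n⟩) f ((3 : ℝ) • f)
      (fun n s => ?_) fun s => ?_
    · have h1 := abs_sub (u n s * w s) ((f : S → ℝ) s)
      have h2 := hub n s
      rw [abs_mul 2, abs_two] at h2
      simp only [Submodule.coe_smul, Pi.smul_apply, smul_eq_mul, abs_mul (3 : ℝ), Nat.abs_ofNat]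
      linarith
    · have := (hu s).mul_const (w s)
      rwa [div_mul_cancel₀ _ (hw0 s).ne'] at this
  have hlim2 : Tendsto (fun n => ∫ s, u n s * ρ s ∂μ) atTop
      (𝓝 (∫ s, (f : S → ℝ) s * (ρ s / w s) ∂μ)) := by
    refine tendsto_integral_of_dominated_convergence
      (fun s => 2 * |(f : S → ℝ) s * (ρ s / w s)|)
      (fun n => ((u n).measurable.mul hρm).aestronglyMeasurable) (hfint.abs.const_mul 2)
      (fun n => ae_of_all _ fun s => ?_) (ae_of_all _ fun s => ?_)
    · have h1 : u n s * ρ s = u n s * w s * (ρ s / w s) := by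
        have := (hw0 s).ne'
        field_simp
      rw [h1, Real.norm_eq_abs, abs_mul, abs_mul ((f : S → ℝ) s), ← mul_assoc]
      refine mul_le_mul_of_nonneg_right ?_ (abs_nonneg _)
      simpa [abs_mul] using hub n s
    · rw [hprod]
      exact (hu s).mul_const (ρ s)
  refine tendsto_nhds_unique hlim1 (hlim2.congr fun n => (hφρ (u n) (hmem n)).symm)

/-- Measurable near-maximizers in the supremum defining the complementary function. -/
lemma exists_measurable_maximizer (hΨ : IsDeltaTwoYoung Ψ) {g : S → ℝ} (hg : Measurable g)
    (q : ℕ → ℝ) (hq : ∀ k, 0 ≤ q k) (n : ℕ) :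
    ∃ F : S → ℝ, Measurable F ∧ (∃ C, ∀ s, F s ≤ C) ∧ (∀ s, 0 ≤ F s) ∧
      (∀ s, 0 ≤ |g s| * F s - Ψ (F s)) ∧
      ∀ k < n, ∀ s, |g s| * q k - Ψ (q k) ≤ |g s| * F s - Ψ (F s) := by
  induction n with
  | zero =>
    exact ⟨fun _ => 0, measurable_const, ⟨0, fun _ => le_rfl⟩, fun _ => le_rfl,
      fun s => by simp [hΨ.apply_zero], fun k hk => absurd hk k.not_lt_zero⟩
  | succ n ih =>
    obtain ⟨F, hFm, ⟨C, hC⟩, hF0, hF, hFq⟩ := ih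
    have hA : MeasurableSet {s | |g s| * F s - Ψ (F s) ≤ |g s| * q n - Ψ (q n)} :=
      measurableSet_le ((hg.abs.mul hFm).sub (hΨ.measurable.comp hFm))
        ((hg.abs.mul_const _).sub_const _)
    classical
    refine ⟨fun s => if |g s| * F s - Ψ (F s) ≤ |g s| * q n - Ψ (q n) then q n else F s,
      Measurable.ite hA measurable_const hFm, ⟨max (q n) C, fun s => ?_⟩, fun s => ?_, fun s => ?_,
      fun k hk s => ?_⟩
    · beta_reduce
      split_ifs
      exacts [le_max_left _ _, (hC s).trans (le_max_right _ _)]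
    · beta_reduce
      split_ifs
      exacts [hq n, hF0 s]
    · beta_reduce
      split_ifs with h
      exacts [(hF s).trans h, hF s]
    · rcases Nat.lt_succ_iff_lt_or_eq.1 hk with hk | rfl
      all_goals
        beta_reduce
        split_ifs with h
      exacts [(hFq k hk s).trans h, hFq k hk s, le_rfl, (not_le.1 h).le]

/-- The density of a functional controlled by the modular is in the complementary class. -/
lemma lintegral_youngConj_le_one [SigmaFinite μ] {g : S → ℝ} (hg : Measurable g)
    (h : ∀ f ∈ orliczSpace μ hΨ, Integrable (fun s => f s * g s) μ ∧
      |∫ s, f s * g s ∂μ| ≤ 1 + (orliczModular μ Ψ f).toReal) :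
    ∫⁻ s, youngConj Ψ (g s) ∂μ ≤ 1 := by
  let q : ℕ → ℝ := fun k => |TopologicalSpace.denseSeq ℝ k|
  choose F hFm hFC hF0 hF hFq using exists_measurable_maximizer hΨ hg q fun k => abs_nonneg _
  let X : ℕ → S → ℝ≥0∞ := fun n =>
    (spanningSets μ n).indicator fun s => ENNReal.ofReal (|g s| * F n s - Ψ (F n s))
  have hXm : ∀ n, Measurable (X n) := fun n =>
    (((hg.abs.mul (hFm n)).sub (hΨ.measurable.comp (hFm n))).ennreal_ofReal).indicator
      (measurableSet_spanningSets μ n)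
  have hX : ∀ n, ∫⁻ s, X n s ∂μ ≤ 1 := by
    intro n
    have hS := measurableSet_spanningSets μ n
    obtain ⟨C, hC⟩ := hFC n
    let sg : S → ℝ := fun s => if 0 ≤ g s then 1 else -1
    have hsgm : Measurable sg :=
      Measurable.ite (measurableSet_le measurable_const hg) measurable_const measurable_const
    have hsg : ∀ s, |sg s| = 1 := fun s => by
      by_cases hs : 0 ≤ g s <;> simp [sg, hs]
    have hsgg : ∀ s, sg s * g s = |g s| := fun s => by
      by_cases hs : 0 ≤ g s
      · simp [sg, hs, abs_of_nonneg hs]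
      · simp [sg, hs, abs_of_neg (not_le.1 hs)]
    let f : S → ℝ := (spanningSets μ n).indicator fun s => F n s * sg s
    have hJ : orliczModular μ Ψ f = ∫⁻ s in spanningSets μ n, ENNReal.ofReal (Ψ (F n s)) ∂μ := by
      rw [← lintegral_indicator hS]
      refine lintegral_congr fun s => ?_
      by_cases hs : s ∈ spanningSets μ n
      · simp [f, hs, abs_mul, hsg, abs_of_nonneg (hF0 n s)]
      · simp [f, hs, hΨ.apply_zero]
    have hf : f ∈ orliczSpace μ hΨ := by
      refine ⟨((hFm n).mul hsgm).indicator hS, ?_⟩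
      rw [hJ]
      calc ∫⁻ s in spanningSets μ n, ENNReal.ofReal (Ψ (F n s)) ∂μ
          ≤ ∫⁻ _ in spanningSets μ n, ENNReal.ofReal (Ψ C) ∂μ :=
            lintegral_mono fun s => ENNReal.ofReal_le_ofReal (hΨ.mono (hF0 n s) (hC s))
        _ = ENNReal.ofReal (Ψ C) * μ (spanningSets μ n) := setLIntegral_const _ _
        _ < ∞ := ENNReal.mul_lt_top ENNReal.ofReal_lt_top (measure_spanningSets_lt_top μ n)
    obtain ⟨hfint, hle⟩ := h f hf
    have hfg : ∀ s, f s * g s = (spanningSets μ n).indicator (fun s => |g s| * F n s) s := by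
      intro s
      by_cases hs : s ∈ spanningSets μ n
      · simp only [f, indicator_of_mem hs]
        rw [mul_assoc, hsgg, mul_comm]
      · simp [f, hs]
    have hfg0 : ∀ s, 0 ≤ f s * g s := fun s => by
      rw [hfg]
      exact indicator_nonneg (fun s _ => mul_nonneg (abs_nonneg _) (hF0 n s)) s
    have hsplit : ∫⁻ s, ENNReal.ofReal (f s * g s) ∂μ = ∫⁻ s, X n s ∂μ + orliczModular μ Ψ f := by
      rw [hJ, ← lintegral_indicator hS, ← lintegral_add_left (hXm n)]
      refine lintegral_congr fun s => ?_
      rw [hfg]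
      by_cases hs : s ∈ spanningSets μ n
      · simp only [X, indicator_of_mem hs]
        rw [← ENNReal.ofReal_add (hF n s) (hΨ.nonneg _), sub_add_cancel]
      · simp [X, hs]
    have hbd : ∫⁻ s, X n s ∂μ + orliczModular μ Ψ f ≤ 1 + orliczModular μ Ψ f := by
      rw [← hsplit, ← ofReal_integral_eq_lintegral_ofReal hfint (ae_of_all _ hfg0)]
      refine (ENNReal.ofReal_le_ofReal ((le_abs_self _).trans hle)).trans ?_
      rw [ENNReal.ofReal_add zero_le_one ENNReal.toReal_nonneg, ENNReal.ofReal_one,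
        ENNReal.ofReal_toReal hf.2.ne]
    exact (ENNReal.add_le_add_iff_right hf.2.ne).1 hbd
  have hpt : ∀ s, youngConj Ψ (g s) ≤ liminf (fun n => X n s) atTop := by
    intro s
    have hk : ∀ k, ENNReal.ofReal (|g s| * q k - Ψ (q k)) ≤ liminf (fun n => X n s) atTop := by
      intro k
      refine le_liminf_of_le (by isBoundedDefault) ?_
      filter_upwards [eventually_gt_atTop k, eventually_ge_atTop (spanningSetsIndex μ s)]
        with n hn hn'
      have hs : s ∈ spanningSets μ n := mem_spanningSets_of_index_le μ s hn'
      simp only [X, indicator_of_mem hs]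
      exact ENNReal.ofReal_le_ofReal (hFq n k hn s)
    have hall : ∀ y : ℝ, ENNReal.ofReal (|g s| * |y| - Ψ |y|) ≤ liminf (fun n => X n s) atTop := by
      intro y
      refine (TopologicalSpace.denseRange_denseSeq ℝ).induction_on y ?_ hk
      refine isClosed_le (ENNReal.continuous_ofReal.comp ?_) continuous_const
      exact (continuous_const.mul continuous_abs).sub (hΨ.continuous.comp continuous_abs)
    refine iSup₂_le fun y hy => ?_
    simpa [abs_of_nonneg hy] using hall y
  calc ∫⁻ s, youngConj Ψ (g s) ∂μ ≤ ∫⁻ s, liminf (fun n => X n s) atTop ∂μ := lintegral_mono hpt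
    _ ≤ liminf (fun n => ∫⁻ s, X n s ∂μ) atTop := lintegral_liminf_le hXm
    _ ≤ 1 := liminf_le_of_le (by isBoundedDefault) fun b hb =>
        let ⟨n, hn⟩ := hb.exists
        hn.trans (hX n)

end Duality

/-- Corollary 2.3 of the paper.
Over a σ-finite measure space, a family `(f_α)` in the Orlicz space `L_Ψ` of a
finite-valued Young function `Ψ` satisfying the Δ₂-condition has dense linear span
(for the Luxemburg norm) if and only if the only `g` in the complementary Orlicz
class annihilating every `f_α` is `g = 0` a.e. -/
theorem orlicz_density_iff_annihilator
    {S : Type*} [MeasurableSpace S] (μ : Measure S) [SigmaFinite μ]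
    (Ψ : ℝ → ℝ)
    (hΨ_nonneg : ∀ x, 0 ≤ Ψ x)
    (hΨ_even : ∀ x, Ψ (-x) = Ψ x)
    (hΨ_convex : ConvexOn ℝ Set.univ Ψ)
    (hΨ_zero : ∀ x, Ψ x = 0 ↔ x = 0)
    (hΨ_Δ₂ : ∃ K > 0, ∀ x ≥ 0, Ψ (2 * x) ≤ K * Ψ x)
    {Λ : Type*} (f : Λ → S → ℝ)
    (hf_meas : ∀ α, Measurable (f α))
    (hf_Orlicz : ∀ α, ∫⁻ s, ENNReal.ofReal (Ψ |f α s|) ∂μ < ⊤) :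
    -- density of the span of `(f_α)` in `L_Ψ` w.r.t. the Luxemburg norm …
    (∀ g : S → ℝ, Measurable g → ∫⁻ s, ENNReal.ofReal (Ψ |g s|) ∂μ < ⊤ →
        ∀ ε > (0 : ℝ), ∃ (n : ℕ) (θ : Fin n → ℝ) (α : Fin n → Λ),
          sInf {a : ℝ | 0 < a ∧
              ∫⁻ s, ENNReal.ofReal (Ψ (|g s - ∑ j, θ j * f (α j) s| / a)) ∂μ ≤ 1} < ε)
      ↔
    -- … iff every `g` in the complementary Orlicz class annihilating the family
    -- vanishes a.e., where `Ψ̄(x) = sup_{y ≥ 0} (|x| y - Ψ y)`: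
    (∀ g : S → ℝ, Measurable g →
        ∫⁻ s, (⨆ (y : ℝ) (_ : 0 ≤ y), ENNReal.ofReal (|g s| * y - Ψ y)) ∂μ < ⊤ →
        (∀ α : Λ, (∫ s, f α s * g s ∂μ) = 0) → g =ᵐ[μ] 0) := by
  have hΨ : IsDeltaTwoYoung Ψ := ⟨hΨ_nonneg, hΨ_even, hΨ_convex, hΨ_zero, hΨ_Δ₂⟩
  let F : Λ → orliczSpace μ hΨ := fun α => ⟨f α, hf_meas α, hf_Orlicz α⟩
  have hlux : ∀ (g : orliczSpace μ hΨ) (n : ℕ) (θ : Fin n → ℝ) (α : Fin n → Λ),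
      luxemburg μ hΨ (g - ∑ j, θ j • F (α j)) = sInf {a : ℝ | 0 < a ∧
        ∫⁻ s, ENNReal.ofReal
          (Ψ (|(g : S → ℝ) s - ∑ j, θ j * f (α j) s| / a)) ∂μ ≤ 1} := by
    intro g n θ α
    rw [luxemburg_apply]
    simp [F]
  constructor
  · intro hdense g hg hg' hann
    change ∫⁻ s, youngConj Ψ (g s) ∂μ < ∞ at hg'
    obtain ⟨w, hw, hw0⟩ := exists_pos_mem_orliczSpace μ hΨ
    have hpos : MeasurableSet {s | 0 ≤ g s} := measurableSet_le measurable_const hg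
    let h : S → ℝ := fun s => (if 0 ≤ g s then 1 else -1) * w s
    have hh : h ∈ orliczSpace μ hΨ :=
      mul_mem_orliczSpace (C := 1) (Measurable.ite hpos measurable_const measurable_const) hw
        fun s => by by_cases hs : 0 ≤ g s <;> simp [hs]
    have hhg : ∀ s, h s * g s = w s * |g s| := by
      intro s
      by_cases hs : 0 ≤ g s
      · simp [h, hs, abs_of_nonneg hs]
      · simp [h, hs, abs_of_neg (not_le.1 hs)]
    have hI : ∀ ε > 0, |∫ s, h s * g s ∂μ| ≤
        ε * (1 + (∫⁻ s, youngConj Ψ (g s) ∂μ).toReal) := by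
      intro ε hε
      obtain ⟨n, θ, α, hlt⟩ := hdense h hh.1 hh.2 ε hε
      rw [← hlux ⟨h, hh⟩ n θ α] at hlt
      obtain ⟨a, ha, haε, hle⟩ := exists_lt_of_luxemburg_lt _ hlt
      have hbd := abs_integral_mul_le (Subtype.mem _) hg hg' ha hle
      have hsub : ∫ s, ((⟨h, hh⟩ - ∑ j, θ j • F (α j) : orliczSpace μ hΨ) : S → ℝ) s * g s ∂μ =
          ∫ s, h s * g s ∂μ := by
        have hfint : ∀ j, Integrable (fun s => θ j * (f (α j) s * g s)) μ := fun j =>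
          (integrable_mul_of_youngConj (F (α j)).2 hg hg').const_mul _
        calc _ = ∫ s, (h s * g s - ∑ j, θ j * (f (α j) s * g s)) ∂μ := by
              refine integral_congr_ae (ae_of_all _ fun s => ?_)
              simp [F, sub_mul, Finset.sum_mul, mul_assoc]
          _ = ∫ s, h s * g s ∂μ - ∑ j, θ j * ∫ s, f (α j) s * g s ∂μ := by
              rw [integral_sub (integrable_mul_of_youngConj hh hg hg')
                (integrable_finsetSum _ fun j _ => hfint j),
                integral_finsetSum _ fun j _ => hfint j]
              simp_rw [integral_const_mul]
          _ = _ := by simp [hann]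
      rw [hsub] at hbd
      exact hbd.trans (mul_le_mul_of_nonneg_right haε.le (by positivity))
    have hzero : ∫ s, h s * g s ∂μ = 0 := by
      have hK : 0 < 1 + (∫⁻ s, youngConj Ψ (g s) ∂μ).toReal := by positivity
      refine abs_nonpos_iff.1 (le_of_forall_pos_le_add fun ε hε => ?_)
      have := hI (ε / (1 + (∫⁻ s, youngConj Ψ (g s) ∂μ).toReal)) (by positivity)
      rwa [div_mul_cancel₀ _ hK.ne', ← zero_add ε] at this
    have hae := (integral_eq_zero_iff_of_nonneg
      (fun s => by simpa [hhg] using mul_nonneg (hw0 s).le (abs_nonneg _))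
      (integrable_mul_of_youngConj hh hg hg')).1 hzero
    filter_upwards [hae] with s hs
    rw [hhg] at hs
    simpa [(hw0 s).ne'] using hs
  · intro hann
    by_contra! hnot
    obtain ⟨g, hg, hg', ε, hε, hfar⟩ := hnot
    obtain ⟨φ, hφ, hφM, hφg⟩ := (luxemburg μ hΨ).exists_functional_of_le
      (Submodule.span ℝ (range F)) ⟨g, hg, hg'⟩ hε (by
        intro m hm
        obtain ⟨n, θ, β, rfl⟩ := Submodule.mem_span_set'.1 hm
        choose α hα using fun j => (β j).2
        simp_rw [← hα]
        rw [hlux]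
        exact hfar n θ α)
    have hφ' : ∀ h, |φ h| ≤ 1 + (orliczModular μ Ψ h).toReal := fun h =>
      (hφ h).trans (luxemburg_le h)
    obtain ⟨ρ, hρ, hrep⟩ := exists_integral_representation φ hφ'
    have hρ' : ∫⁻ s, youngConj Ψ (ρ s) ∂μ ≤ 1 :=
      lintegral_youngConj_le_one hρ fun h hh =>
        ⟨(hrep ⟨h, hh⟩).1, (hrep ⟨h, hh⟩).2 ▸ hφ' ⟨h, hh⟩⟩
    have hρ0 : ρ =ᵐ[μ] 0 := by
      refine hann ρ hρ (hρ'.trans_lt ENNReal.one_lt_top) fun α => ?_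
      rw [← (hrep (F α)).2]
      exact hφM _ (Submodule.subset_span (mem_range_self α))
    refine hφg ((hrep _).2.trans (integral_eq_zero_of_ae ?_))
    filter_upwards [hρ0] with s hs
    simp [hs]
end
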